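/- Let N ≥ 4 be a real number, T > 0, n ∈ ℕ, M > 0. Let b₂, b₁, b₀ ∈ C^∞([0,T]×[0,1]) satisfy |b₂ − 1| ≤ 1/2 everywhere and |b⃗|₆^T ≤ M, where b⃗ = (b₂,b₁,b₀). Let τ₂ ∈ (0,T), let G ∈ C^∞([0,T]×[0,1]) vanish for 0 ≤ t ≤ τ₂, and let H ∈ C^∞([0,T]×[0,1]) satisfy ∂_t²H + 𝒜H = G on [0,T]×(0,1), H(t,1) = 0 for all t, and H(t,·) = 0 for 0 ≤ t ≤ τ₂. Set G_j := ∂_t^j G − (∂_t^j(𝒜H) − 𝒜(∂_t^j H)). Then there is a constant C = C(n, M, N, T) such that: ∑_{j+k=n} ( ∫₀^T ‖G_j(t,·)‖_k² dt )^{1/2} ≤ C·( ‖G‖_n^T + ‖H‖_{n+1}^T + |b⃗|_{n+4}^T·‖H‖₂^T + |b⃗|_{n+5}^T·‖H‖₁^T ). -/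

import Mathlib

open MeasureTheory Real Set

noncomputable section

/-- The degenerate operator `Δy(z) = z y''(z) + (N/2) y'(z)`. -/
def Del (N : ℝ) (f : ℝ → ℝ) : ℝ → ℝ :=
  fun z => z * deriv (deriv f) z + (N / 2) * deriv f z

/-- Iterates `Δ^m`. -/
def DelIter (N : ℝ) : ℕ → (ℝ → ℝ) → ℝ → ℝ
  | 0 => fun f => f
  | m + 1 => fun f => Del N (DelIter N m f)

/-- `Ḋ = √z d/dz`. -/
def Ddot (f : ℝ → ℝ) : ℝ → ℝ := fun z => Real.sqrt z * deriv f z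

/-- The weighted L² norm on (0,1). -/
def Xnorm (N : ℝ) (f : ℝ → ℝ) : ℝ :=
  Real.sqrt (∫ z in (0:ℝ)..1, (f z) ^ 2 * z ^ (N / 2 - 1))

/-- Graded seminorms `(y)_ℓ`. -/
def gnorm (N : ℝ) (ℓ : ℕ) (f : ℝ → ℝ) : ℝ :=
  if ℓ % 2 = 0 then Xnorm N (DelIter N (ℓ / 2) f)
  else Xnorm N (Ddot (DelIter N (ℓ / 2) f))

/-- Graded norm `‖y‖_n`. -/
def normN (N : ℝ) (n : ℕ) (f : ℝ → ℝ) : ℝ :=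
  Real.sqrt (∑ ℓ ∈ Finset.range (n + 1), (gnorm N ℓ f) ^ 2)

/-- Sup norm on [0,1]. -/
def supN (f : ℝ → ℝ) : ℝ := ⨆ z : Icc (0:ℝ) 1, |f z.1|

/-- `|y|_n = ∑_{ℓ≤n} ‖Ḋ^ℓ y‖_{L^∞(0,1)}`. -/
def supLow (n : ℕ) (f : ℝ → ℝ) : ℝ := ∑ ℓ ∈ Finset.range (n + 1), supN (Ddot^[ℓ] f)

/-- Time derivative of a function of (t,z). -/
def dt (y : ℝ → ℝ → ℝ) : ℝ → ℝ → ℝ := fun t z => deriv (fun s => y s z) t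

/-- Sup norm on [0,T]×[0,1]. -/
def supT (T : ℝ) (y : ℝ → ℝ → ℝ) : ℝ :=
  ⨆ (t : Icc (0:ℝ) T) (z : Icc (0:ℝ) 1), |y t.1 z.1|

/-- `|y|_n^T = sup_{j+k≤n} ‖∂_t^j Ḋ^k y‖_{L^∞([0,T]×[0,1])}`. -/
def supNT (T : ℝ) (n : ℕ) (y : ℝ → ℝ → ℝ) : ℝ :=
  ⨆ p : {p : ℕ × ℕ // p.1 + p.2 ≤ n}, supT T (fun t => Ddot^[p.1.2] (dt^[p.1.1] y t))

/-- `‖y‖_n^T`. -/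
def normT (N T : ℝ) (n : ℕ) (y : ℝ → ℝ → ℝ) : ℝ :=
  Real.sqrt (∑ j ∈ Finset.range (n + 1), ∑ k ∈ Finset.range (n + 1 - j),
    ∫ t in (0:ℝ)..T, (normN N k (dt^[j] y t)) ^ 2)

/-- `Z_n(H)(t) = ∑_{j+k=n} ‖∂_t^j H(t,·)‖_k`. -/
def ZZ (N : ℝ) (n : ℕ) (H : ℝ → ℝ → ℝ) (t : ℝ) : ℝ :=
  ∑ j ∈ Finset.range (n + 1), normN N (n - j) (dt^[j] H t)

/-- The operator `𝒜h = -b₂ Δh + b₁ Ďh + b₀ h` with time-dependent coefficients. -/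
def opA (N : ℝ) (b₂ b₁ b₀ : ℝ → ℝ → ℝ) (H : ℝ → ℝ → ℝ) : ℝ → ℝ → ℝ :=
  fun t z => -(b₂ t z) * Del N (H t) z + b₁ t z * (z * deriv (H t) z) + b₀ t z * H t z

end


namespace S13

/-- Jointly smooth functions of (t,z). -/
def Sm (F : ℝ → ℝ → ℝ) : Prop := ContDiff ℝ (⊤ : ℕ∞) (fun p : ℝ × ℝ => F p.1 p.2)

/-- Jointly continuous functions. -/
def Co (F : ℝ → ℝ → ℝ) : Prop := Continuous (fun p : ℝ × ℝ => F p.1 p.2)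

/-- z-derivative. -/
noncomputable def dz (F : ℝ → ℝ → ℝ) : ℝ → ℝ → ℝ := fun t z => deriv (F t) z

/-- Space-time version of `Del`. -/
noncomputable def delT (N : ℝ) (F : ℝ → ℝ → ℝ) : ℝ → ℝ → ℝ := fun t => Del N (F t)

theorem Sm.co {F} (h : Sm F) : Co F := ContDiff.continuous h

theorem Sm.hasF {F} (h : Sm F) (p : ℝ × ℝ) :
    HasFDerivAt (fun p : ℝ × ℝ => F p.1 p.2) (fderiv ℝ (fun p : ℝ × ℝ => F p.1 p.2) p) p :=
  (ContDiff.differentiable h (by simp) p).hasFDerivAt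

theorem Sm.hz' {F} (h : Sm F) (t z : ℝ) :
    HasDerivAt (F t) (fderiv ℝ (fun p : ℝ × ℝ => F p.1 p.2) (t, z) (0, 1)) z := by
  have h1 : HasDerivAt (fun y : ℝ => ((t, y) : ℝ × ℝ)) (0, 1) z :=
    (hasDerivAt_const z t).prodMk (hasDerivAt_id z)
  exact (h.hasF (t, z)).comp_hasDerivAt z h1

theorem Sm.ht' {F} (h : Sm F) (t z : ℝ) :
    HasDerivAt (fun s => F s z) (fderiv ℝ (fun p : ℝ × ℝ => F p.1 p.2) (t, z) (1, 0)) t := by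
  have h1 : HasDerivAt (fun y : ℝ => ((y, z) : ℝ × ℝ)) (1, 0) t :=
    (hasDerivAt_id t).prodMk (hasDerivAt_const t z)
  exact (h.hasF (t, z)).comp_hasDerivAt t h1

theorem Sm.hz {F} (h : Sm F) (t z : ℝ) : HasDerivAt (F t) (dz F t z) z :=
  (h.hz' t z).differentiableAt.hasDerivAt

theorem Sm.ht {F} (h : Sm F) (t z : ℝ) : HasDerivAt (fun s => F s z) (dt F t z) t :=
  (h.ht' t z).differentiableAt.hasDerivAt

theorem Sm.fd {F} (h : Sm F) (v : ℝ × ℝ) :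
    ContDiff ℝ (⊤ : ℕ∞) (fun p : ℝ × ℝ => fderiv ℝ (fun p : ℝ × ℝ => F p.1 p.2) p v) := by
  have : ContDiff ℝ (⊤ : ℕ∞) (fderiv ℝ (fun p : ℝ × ℝ => F p.1 p.2)) :=
    ContDiff.fderiv_right h (by norm_cast)
  exact this.clm_apply contDiff_const

theorem dz_eq {F} (h : Sm F) :
    dz F = fun t z => fderiv ℝ (fun p : ℝ × ℝ => F p.1 p.2) (t, z) (0, 1) := by
  funext t z; exact (h.hz' t z).deriv

theorem dt_eq {F} (h : Sm F) :
    dt F = fun t z => fderiv ℝ (fun p : ℝ × ℝ => F p.1 p.2) (t, z) (1, 0) := by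
  funext t z; exact (h.ht' t z).deriv

theorem Sm.dz {F} (h : Sm F) : Sm (dz F) := by
  rw [dz_eq h]; exact h.fd (0, 1)

theorem Sm.dt {F} (h : Sm F) : Sm (dt F) := by
  rw [dt_eq h]; exact h.fd (1, 0)

theorem dt_dz {F} (h : Sm F) : _root_.dt (S13.dz F) = S13.dz (_root_.dt F) := by
  funext t z
  have h1 := h.dz.ht' t z
  have h2 := h.dt.hz' t z
  have e1 : _root_.dt (S13.dz F) t z = _ := h1.deriv
  have e2 : S13.dz (_root_.dt F) t z = _ := h2.deriv
  rw [e1, e2, dz_eq h, dt_eq h]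
  have hd : DifferentiableAt ℝ (fderiv ℝ (fun p : ℝ × ℝ => F p.1 p.2)) (t, z) := by
    have : ContDiff ℝ (⊤ : ℕ∞) (fderiv ℝ (fun p : ℝ × ℝ => F p.1 p.2)) :=
      ContDiff.fderiv_right h (by norm_cast)
    exact this.differentiable (by simp) _
  have key : ∀ v w : ℝ × ℝ, fderiv ℝ (fun p : ℝ × ℝ => fderiv ℝ (fun p : ℝ × ℝ => F p.1 p.2) p v) (t, z) w
      = fderiv ℝ (fderiv ℝ (fun p : ℝ × ℝ => F p.1 p.2)) (t, z) w v := by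
    intro v w
    rw [fderiv_clm_apply hd (differentiableAt_const v)]
    simp
  have hs : IsSymmSndFDerivAt ℝ (fun p : ℝ × ℝ => F p.1 p.2) (t, z) :=
    (ContDiff.contDiffAt h).isSymmSndFDerivAt (by simp; norm_cast)
  have k1 := key (0, 1) (1, 0)
  have k2 := key (1, 0) (0, 1)
  have := hs.eq (1, 0) (0, 1)
  simp only at *
  rw [k1, k2, this]

theorem Sm.add {F G} (hF : Sm F) (hG : Sm G) : Sm (fun t z => F t z + G t z) := ContDiff.add hF hG
theorem Sm.sub {F G} (hF : Sm F) (hG : Sm G) : Sm (fun t z => F t z - G t z) := ContDiff.sub hF hG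
theorem Sm.neg {F} (hF : Sm F) : Sm (fun t z => - F t z) := ContDiff.neg hF
theorem Sm.mul {F G} (hF : Sm F) (hG : Sm G) : Sm (fun t z => F t z * G t z) := ContDiff.mul hF hG
theorem Sm.const (c : ℝ) : Sm (fun _ _ => c) := contDiff_const
theorem Sm.z : Sm (fun _ z => z) := contDiff_snd
theorem Sm.zpow (e : ℕ) : Sm (fun _ z => z ^ e) := contDiff_snd.pow e
theorem Sm.smul {F} (c : ℝ) (hF : Sm F) : Sm (fun t z => c * F t z) := (Sm.const c).mul hF

theorem Co.add {F G} (hF : Co F) (hG : Co G) : Co (fun t z => F t z + G t z) := Continuous.add hF hG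
theorem Co.sub {F G} (hF : Co F) (hG : Co G) : Co (fun t z => F t z - G t z) := Continuous.sub hF hG
theorem Co.mul {F G} (hF : Co F) (hG : Co G) : Co (fun t z => F t z * G t z) := Continuous.mul hF hG
theorem Co.const (c : ℝ) : Co (fun _ _ => c) := continuous_const
theorem Co.smul {F} (c : ℝ) (hF : Co F) : Co (fun t z => c * F t z) := (Co.const c).mul hF
theorem Co.sqrtz : Co (fun _ z => Real.sqrt z) := Real.continuous_sqrt.comp continuous_snd

theorem delT_eq (N : ℝ) (F) : delT N F = fun t z => z * dz (dz F) t z + N / 2 * dz F t z := rfl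

theorem Sm.delT {F} (N : ℝ) (h : Sm F) : Sm (delT N F) := by
  rw [delT_eq]; exact (Sm.z.mul h.dz.dz).add (h.dz.smul _)

theorem dz_of {F G : ℝ → ℝ → ℝ} (h : ∀ t z, HasDerivAt (F t) (G t z) z) : dz F = G := by
  funext t z; exact (h t z).deriv

theorem dt_of {F G : ℝ → ℝ → ℝ} (h : ∀ t z, HasDerivAt (fun s => F s z) (G t z) t) : dt F = G := by
  funext t z; exact (h t z).deriv

theorem dz_add {F G} (hF : Sm F) (hG : Sm G) :
    dz (fun t z => F t z + G t z) = fun t z => dz F t z + dz G t z :=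
  dz_of fun t z => (hF.hz t z).add (hG.hz t z)
theorem dz_sub {F G} (hF : Sm F) (hG : Sm G) :
    dz (fun t z => F t z - G t z) = fun t z => dz F t z - dz G t z :=
  dz_of fun t z => (hF.hz t z).sub (hG.hz t z)
theorem dz_mul {F G} (hF : Sm F) (hG : Sm G) :
    dz (fun t z => F t z * G t z) = fun t z => dz F t z * G t z + F t z * dz G t z :=
  dz_of fun t z => (hF.hz t z).mul (hG.hz t z)
theorem dz_smul {F} (c : ℝ) (hF : Sm F) :
    dz (fun t z => c * F t z) = fun t z => c * dz F t z :=
  dz_of fun t z => (hF.hz t z).const_mul c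
theorem dt_add {F G} (hF : Sm F) (hG : Sm G) :
    dt (fun t z => F t z + G t z) = fun t z => dt F t z + dt G t z :=
  dt_of fun t z => (hF.ht t z).add (hG.ht t z)
theorem dt_sub {F G} (hF : Sm F) (hG : Sm G) :
    dt (fun t z => F t z - G t z) = fun t z => dt F t z - dt G t z :=
  dt_of fun t z => (hF.ht t z).sub (hG.ht t z)
theorem dt_mul {F G} (hF : Sm F) (hG : Sm G) :
    dt (fun t z => F t z * G t z) = fun t z => dt F t z * G t z + F t z * dt G t z :=
  dt_of fun t z => (hF.ht t z).mul (hG.ht t z)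
theorem dt_smul {F} (c : ℝ) (hF : Sm F) :
    dt (fun t z => c * F t z) = fun t z => c * dt F t z :=
  dt_of fun t z => (hF.ht t z).const_mul c

theorem dz_zpow (e : ℕ) : dz (fun _ z => z ^ e) = fun _ z => (e : ℝ) * z ^ (e - 1) :=
  dz_of fun _ z => hasDerivAt_pow e z
theorem dt_zpow (e : ℕ) : dt (fun _ z => z ^ e) = fun _ _ => 0 :=
  dt_of fun t z => hasDerivAt_const t (z ^ e)
theorem dz_z : dz (fun _ z => z) = fun _ _ => 1 := dz_of fun _ z => hasDerivAt_id z
theorem dt_z : dt (fun _ z => z) = fun _ _ => 0 := dt_of fun t z => hasDerivAt_const t z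

theorem delT_add {F G} (N : ℝ) (hF : Sm F) (hG : Sm G) :
    delT N (fun t z => F t z + G t z) = fun t z => delT N F t z + delT N G t z := by
  rw [delT_eq, dz_add hF hG, dz_add hF.dz hG.dz]
  funext t z; simp only [delT_eq]; ring
theorem delT_sub {F G} (N : ℝ) (hF : Sm F) (hG : Sm G) :
    delT N (fun t z => F t z - G t z) = fun t z => delT N F t z - delT N G t z := by
  rw [delT_eq, dz_sub hF hG, dz_sub hF.dz hG.dz]
  funext t z; simp only [delT_eq]; ring
theorem delT_smul {F} (N c : ℝ) (hF : Sm F) :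
    delT N (fun t z => c * F t z) = fun t z => c * delT N F t z := by
  rw [delT_eq, dz_smul c hF, dz_smul c hF.dz]
  funext t z; simp only [delT_eq]; ring

theorem dt_delT {F} (N : ℝ) (h : Sm F) : dt (delT N F) = delT N (dt F) := by
  rw [delT_eq, dt_add (Sm.z.mul h.dz.dz) (h.dz.smul _), dt_mul Sm.z h.dz.dz, dt_smul _ h.dz,
    dt_dz h.dz, dt_dz h, dt_z]
  funext t z; simp only [delT_eq]; ring

theorem delT_mul {F G} (N : ℝ) (hF : Sm F) (hG : Sm G) :
    delT N (fun t z => F t z * G t z) = fun t z =>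
      F t z * delT N G t z + 2 * dz F t z * (z * dz G t z) + delT N F t z * G t z := by
  rw [delT_eq, dz_mul hF hG, dz_add (hF.dz.mul hG) (hF.mul hG.dz), dz_mul hF.dz hG,
    dz_mul hF hG.dz]
  funext t z; simp only [delT_eq]; ring

theorem Sm.dt_iter {F} (h : Sm F) (j : ℕ) : Sm (_root_.dt^[j] F) := by
  induction j with
  | zero => exact h
  | succ j ih => rw [Function.iterate_succ_apply']; exact ih.dt
theorem Sm.dz_iter {F} (h : Sm F) (j : ℕ) : Sm (S13.dz^[j] F) := by
  induction j with
  | zero => exact h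
  | succ j ih => rw [Function.iterate_succ_apply']; exact ih.dz
theorem Sm.delT_iter {F} (N : ℝ) (h : Sm F) (j : ℕ) : Sm ((S13.delT N)^[j] F) := by
  induction j with
  | zero => exact h
  | succ j ih => rw [Function.iterate_succ_apply']; exact ih.delT N

theorem dt_dz_iter {F} (h : Sm F) (k : ℕ) : dt (dz^[k] F) = dz^[k] (dt F) := by
  induction k with
  | zero => rfl
  | succ k ih => rw [Function.iterate_succ_apply', Function.iterate_succ_apply',
      dt_dz (h.dz_iter k), ih]
theorem dt_delT_iter {F} (N : ℝ) (h : Sm F) (k : ℕ) :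
    dt ((delT N)^[k] F) = (delT N)^[k] (dt F) := by
  induction k with
  | zero => rfl
  | succ k ih => rw [Function.iterate_succ_apply', Function.iterate_succ_apply',
      dt_delT N (h.delT_iter N k), ih]

theorem delT_iter_sub {F G} (N : ℝ) (hF : Sm F) (hG : Sm G) (k : ℕ) :
    (delT N)^[k] (fun t z => F t z - G t z)
      = fun t z => (delT N)^[k] F t z - (delT N)^[k] G t z := by
  induction k with
  | zero => rfl
  | succ k ih => simp only [Function.iterate_succ_apply']
                 rw [ih, delT_sub N (hF.delT_iter N k) (hG.delT_iter N k)]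

theorem DelIter_eq (N : ℝ) (m : ℕ) (F : ℝ → ℝ → ℝ) (t : ℝ) :
    DelIter N m (F t) = (delT N)^[m] F t := by
  induction m with
  | zero => rfl
  | succ m ih => rw [Function.iterate_succ_apply']; simp only [DelIter, ih, delT]

end S13

namespace S13

/-- Weighted space integral of a square. -/
noncomputable def sq (N : ℝ) (f : ℝ → ℝ) : ℝ := ∫ z in (0:ℝ)..1, (f z) ^ 2 * z ^ (N / 2 - 1)

/-- Weighted space-time integral of a square. -/
noncomputable def dbl (N T : ℝ) (F : ℝ → ℝ → ℝ) : ℝ := ∫ t in (0:ℝ)..T, sq N (F t)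

theorem Co.zw {N : ℝ} (hN : 4 ≤ N) : Co (fun _ z => z ^ (N / 2 - 1)) :=
  (Real.continuous_rpow_const (by linarith)).comp continuous_snd

theorem Co.sl {F} (h : Co F) (t : ℝ) : Continuous (F t) :=
  Continuous.comp (g := fun p : ℝ × ℝ => F p.1 p.2) h (by fun_prop : Continuous fun z : ℝ => ((t, z) : ℝ × ℝ))
theorem Co.slt {F} (h : Co F) (z : ℝ) : Continuous (fun t => F t z) :=
  Continuous.comp (g := fun p : ℝ × ℝ => F p.1 p.2) h (by fun_prop : Continuous fun t : ℝ => ((t, z) : ℝ × ℝ))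

theorem Co.sqw {N : ℝ} (hN : 4 ≤ N) {F} (h : Co F) :
    Co (fun t z => (F t z) ^ 2 * z ^ (N / 2 - 1)) :=
  Continuous.mul (Continuous.pow h 2) (Co.zw hN)

theorem sq_cont {N : ℝ} (hN : 4 ≤ N) {F} (h : Co F) : Continuous (fun t => sq N (F t)) := by
  unfold sq
  have h1 : Continuous (Function.uncurry fun t z => (F t z) ^ 2 * z ^ (N / 2 - 1)) := h.sqw hN
  exact intervalIntegral.continuous_parametric_intervalIntegral_of_continuous' h1 0 1

theorem sq_nonneg' (N : ℝ) (f) : 0 ≤ sq N f := by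
  apply intervalIntegral.integral_nonneg zero_le_one
  intro z hz
  have := Real.rpow_nonneg hz.1 (N / 2 - 1)
  positivity

theorem sq_mono {N : ℝ} (hN : 4 ≤ N) {f g : ℝ → ℝ} (hf : Continuous f) (hg : Continuous g)
    (h : ∀ z ∈ Icc (0:ℝ) 1, |f z| ≤ |g z|) : sq N f ≤ sq N g := by
  have hw : Continuous fun z : ℝ => z ^ (N / 2 - 1) := Real.continuous_rpow_const (by linarith)
  apply intervalIntegral.integral_mono_on zero_le_one
  · exact ((hf.pow 2).mul hw).intervalIntegrable _ _
  · exact ((hg.pow 2).mul hw).intervalIntegrable _ _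
  · intro z hz
    have := Real.rpow_nonneg hz.1 (N / 2 - 1)
    have := sq_le_sq.2 (h z hz)
    gcongr

theorem sq_add {N : ℝ} (hN : 4 ≤ N) {f g : ℝ → ℝ} (hf : Continuous f) (hg : Continuous g) :
    sq N (fun z => f z + g z) ≤ 2 * sq N f + 2 * sq N g := by
  have hw : Continuous fun z : ℝ => z ^ (N / 2 - 1) := Real.continuous_rpow_const (by linarith)
  have i1 : IntervalIntegrable (fun z => f z ^ 2 * z ^ (N / 2 - 1)) volume 0 1 :=
    ((hf.pow 2).mul hw).intervalIntegrable 0 1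
  have i2 : IntervalIntegrable (fun z => g z ^ 2 * z ^ (N / 2 - 1)) volume 0 1 :=
    ((hg.pow 2).mul hw).intervalIntegrable 0 1
  unfold sq
  rw [← intervalIntegral.integral_const_mul, ← intervalIntegral.integral_const_mul,
    ← intervalIntegral.integral_add (i1.const_mul 2) (i2.const_mul 2)]
  apply intervalIntegral.integral_mono_on zero_le_one
  · exact (((hf.add hg).pow 2).mul hw).intervalIntegrable _ _
  · exact (i1.const_mul 2).add (i2.const_mul 2)
  · intro z hz
    have := Real.rpow_nonneg hz.1 (N / 2 - 1)
    have h2 : (f z + g z) ^ 2 ≤ 2 * f z ^ 2 + 2 * g z ^ 2 := by nlinarith [sq_nonneg (f z - g z)]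
    calc _ ≤ (2 * f z ^ 2 + 2 * g z ^ 2) * z ^ (N / 2 - 1) := by gcongr
      _ = _ := by ring

theorem sq_smul (N c : ℝ) (f : ℝ → ℝ) : sq N (fun z => c * f z) = c ^ 2 * sq N f := by
  unfold sq
  rw [← intervalIntegral.integral_const_mul]
  congr 1; funext z; ring

theorem dbl_nonneg {N T : ℝ} (hT : 0 < T) (F) : 0 ≤ dbl N T F :=
  intervalIntegral.integral_nonneg hT.le fun _ _ => sq_nonneg' N _

theorem dbl_mono {N T : ℝ} (hN : 4 ≤ N) (hT : 0 < T) {F G} (hF : Co F) (hG : Co G)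
    (h : ∀ t ∈ Icc 0 T, ∀ z ∈ Icc (0:ℝ) 1, |F t z| ≤ |G t z|) : dbl N T F ≤ dbl N T G := by
  apply intervalIntegral.integral_mono_on hT.le
  · exact (sq_cont hN hF).intervalIntegrable _ _
  · exact (sq_cont hN hG).intervalIntegrable _ _
  · intro t ht
    exact sq_mono hN (hF.sl t) (hG.sl t) (h t ht)

theorem dbl_add {N T : ℝ} (hN : 4 ≤ N) (hT : 0 < T) {F G} (hF : Co F) (hG : Co G) :
    dbl N T (fun t z => F t z + G t z) ≤ 2 * dbl N T F + 2 * dbl N T G := by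
  have i1 := (sq_cont hN hF).intervalIntegrable (μ := volume) 0 T
  have i2 := (sq_cont hN hG).intervalIntegrable (μ := volume) 0 T
  unfold dbl
  rw [← intervalIntegral.integral_const_mul, ← intervalIntegral.integral_const_mul,
    ← intervalIntegral.integral_add (i1.const_mul 2) (i2.const_mul 2)]
  apply intervalIntegral.integral_mono_on hT.le
  · exact (sq_cont hN (hF.add hG)).intervalIntegrable _ _
  · exact (i1.const_mul 2).add (i2.const_mul 2)
  · intro t ht
    exact sq_add hN (hF.sl t) (hG.sl t)

theorem dbl_smul (N T c : ℝ) (F : ℝ → ℝ → ℝ) :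
    dbl N T (fun t z => c * F t z) = c ^ 2 * dbl N T F := by
  unfold dbl
  rw [← intervalIntegral.integral_const_mul]
  congr 1; funext t; exact sq_smul N c (F t)

/-- The graded derivative of order `ℓ`. -/
noncomputable def grad (N : ℝ) (l : ℕ) (F : ℝ → ℝ → ℝ) : ℝ → ℝ → ℝ :=
  if l % 2 = 0 then (delT N)^[l / 2] F
  else fun t z => Real.sqrt z * dz ((delT N)^[l / 2] F) t z

theorem Sm.grad_co {F} (N : ℝ) (l : ℕ) (h : Sm F) : Co (grad N l F) := by
  unfold grad; split_ifs
  · exact (h.delT_iter N _).co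
  · exact Co.sqrtz.mul (h.delT_iter N _).dz.co

theorem grad_even (N : ℝ) (m : ℕ) (F) : grad N (2 * m) F = (delT N)^[m] F := by
  unfold grad
  rw [if_pos (by omega), show 2 * m / 2 = m by omega]
theorem grad_odd (N : ℝ) (m : ℕ) (F) :
    grad N (2 * m + 1) F = fun t z => Real.sqrt z * dz ((delT N)^[m] F) t z := by
  unfold grad
  rw [if_neg (by omega), show (2 * m + 1) / 2 = m by omega]

theorem grad_sub {F G} (N : ℝ) (l : ℕ) (hF : Sm F) (hG : Sm G) :
    grad N l (fun t z => F t z - G t z) = fun t z => grad N l F t z - grad N l G t z := by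
  unfold grad; split_ifs
  · exact delT_iter_sub N hF hG _
  · rw [delT_iter_sub N hF hG, dz_sub (hF.delT_iter N _) (hG.delT_iter N _)]
    funext t z; ring

theorem gnorm_sq (N : ℝ) (l : ℕ) (F : ℝ → ℝ → ℝ) (t : ℝ) :
    (gnorm N l (F t)) ^ 2 = sq N (grad N l F t) := by
  unfold gnorm grad
  split_ifs with h
  · rw [DelIter_eq]; exact Real.sq_sqrt (sq_nonneg' N _)
  · rw [DelIter_eq]; exact Real.sq_sqrt (sq_nonneg' N _)

theorem normN_sq (N : ℝ) (k : ℕ) (F : ℝ → ℝ → ℝ) (t : ℝ) :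
    (normN N k (F t)) ^ 2 = ∑ l ∈ Finset.range (k + 1), sq N (grad N l F t) := by
  unfold normN
  rw [Real.sq_sqrt (Finset.sum_nonneg fun _ _ => sq_nonneg _)]
  exact Finset.sum_congr rfl fun l _ => gnorm_sq N l F t

theorem int_normN {N T : ℝ} (hN : 4 ≤ N) (k : ℕ) {F} (h : Sm F) :
    ∫ t in (0:ℝ)..T, (normN N k (F t)) ^ 2
      = ∑ l ∈ Finset.range (k + 1), dbl N T (grad N l F) := by
  simp only [normN_sq]
  rw [intervalIntegral.integral_finsetSum]
  · rfl
  · intro l _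
    exact (sq_cont hN (h.grad_co N l)).intervalIntegrable _ _

/-- Square of `normT`. -/
noncomputable def hsq (N T : ℝ) (k : ℕ) (F : ℝ → ℝ → ℝ) : ℝ := (normT N T k F) ^ 2

theorem hsq_eq {N T : ℝ} (hN : 4 ≤ N) (hT : 0 < T) (n : ℕ) {F} (h : Sm F) :
    hsq N T n F = ∑ j ∈ Finset.range (n + 1), ∑ k ∈ Finset.range (n + 1 - j),
      ∑ l ∈ Finset.range (k + 1), dbl N T (grad N l (dt^[j] F)) := by
  unfold hsq normT
  rw [Real.sq_sqrt]
  · exact Finset.sum_congr rfl fun j _ => Finset.sum_congr rfl fun k _ =>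
      int_normN hN k (h.dt_iter j)
  · refine Finset.sum_nonneg fun j _ => Finset.sum_nonneg fun k _ => ?_
    exact intervalIntegral.integral_nonneg hT.le fun _ _ => sq_nonneg _

theorem dbl_le_hsq {N T : ℝ} (hN : 4 ≤ N) (hT : 0 < T) {n j l : ℕ} (hjl : j + l ≤ n) {F}
    (h : Sm F) : dbl N T (grad N l (dt^[j] F)) ≤ hsq N T n F := by
  rw [hsq_eq hN hT n h]
  have h0 : ∀ l j, 0 ≤ dbl N T (grad N l (dt^[j] F)) := fun l j => dbl_nonneg hT _
  have s1 : dbl N T (grad N l (dt^[j] F)) ≤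
      ∑ l ∈ Finset.range (l + 1), dbl N T (grad N l (dt^[j] F)) :=
    Finset.single_le_sum (f := fun l => dbl N T (grad N l (dt^[j] F)))
      (fun i _ => h0 i j) (Finset.mem_range.2 (by omega))
  have s2 : ∑ l ∈ Finset.range (l + 1), dbl N T (grad N l (dt^[j] F)) ≤
      ∑ k ∈ Finset.range (n + 1 - j), ∑ l ∈ Finset.range (k + 1),
        dbl N T (grad N l (dt^[j] F)) :=
    Finset.single_le_sum
      (f := fun k => ∑ l ∈ Finset.range (k + 1), dbl N T (grad N l (dt^[j] F)))
      (fun i _ => Finset.sum_nonneg fun _ _ => h0 _ _) (Finset.mem_range.2 (by omega))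
  refine s1.trans (s2.trans ?_)
  exact Finset.single_le_sum
      (f := fun j => ∑ k ∈ Finset.range (n + 1 - j), ∑ l ∈ Finset.range (k + 1),
        dbl N T (grad N l (dt^[j] F)))
      (fun i _ => Finset.sum_nonneg fun _ _ => Finset.sum_nonneg fun _ _ => h0 _ _)
      (Finset.mem_range.2 (by omega))

theorem hsq_le {N T : ℝ} (hN : 4 ≤ N) (hT : 0 < T) (n : ℕ) {F} (h : Sm F) (X : ℝ) (hX : 0 ≤ X)
    (hb : ∀ j l, j + l ≤ n → dbl N T (grad N l (dt^[j] F)) ≤ X) :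
    hsq N T n F ≤ ((n + 1 : ℕ) : ℝ) ^ 3 * X := by
  rw [hsq_eq hN hT n h]
  have : ∀ j ∈ Finset.range (n + 1), ∑ k ∈ Finset.range (n + 1 - j),
      ∑ l ∈ Finset.range (k + 1), dbl N T (grad N l (dt^[j] F)) ≤ ((n + 1 : ℕ) : ℝ) ^ 2 * X := by
    intro j hj
    have : ∀ k ∈ Finset.range (n + 1 - j), ∑ l ∈ Finset.range (k + 1),
        dbl N T (grad N l (dt^[j] F)) ≤ ((n + 1 : ℕ) : ℝ) * X := by
      intro k hk
      simp only [Finset.mem_range] at hj hk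
      calc _ ≤ ∑ l ∈ Finset.range (k + 1), X := Finset.sum_le_sum fun l hl => hb j l (by
            simp only [Finset.mem_range] at hl; omega)
        _ = ((k + 1 : ℕ) : ℝ) * X := by simp
        _ ≤ _ := by gcongr; omega
    calc _ ≤ ∑ k ∈ Finset.range (n + 1 - j), ((n + 1 : ℕ) : ℝ) * X := Finset.sum_le_sum this
      _ = ((n + 1 - j : ℕ) : ℝ) * (((n + 1 : ℕ) : ℝ) * X) := by simp
      _ ≤ ((n + 1 : ℕ) : ℝ) * (((n + 1 : ℕ) : ℝ) * X) := by gcongr; omega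
      _ = _ := by ring
  calc _ ≤ ∑ j ∈ Finset.range (n + 1), ((n + 1 : ℕ) : ℝ) ^ 2 * X := Finset.sum_le_sum this
    _ = _ := by simp; ring

theorem hsq_nonneg (N T : ℝ) (k F) : 0 ≤ hsq N T k F := sq_nonneg _

theorem hsq_mono {N T : ℝ} (hN : 4 ≤ N) (hT : 0 < T) {m n : ℕ} (hmn : m ≤ n) {F} (h : Sm F) :
    hsq N T m F ≤ hsq N T n F := by
  rw [hsq_eq hN hT n h, hsq_eq hN hT m h]
  have h0 : ∀ l j, 0 ≤ dbl N T (grad N l (dt^[j] F)) := fun l j => dbl_nonneg hT _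
  calc _ ≤ ∑ j ∈ Finset.range (m + 1), ∑ k ∈ Finset.range (n + 1 - j),
      ∑ l ∈ Finset.range (k + 1), dbl N T (grad N l (dt^[j] F)) := by
        refine Finset.sum_le_sum fun j _ => ?_
        exact Finset.sum_le_sum_of_subset_of_nonneg (Finset.range_mono (by omega))
          fun _ _ _ => Finset.sum_nonneg fun _ _ => h0 _ _
    _ ≤ _ := Finset.sum_le_sum_of_subset_of_nonneg (Finset.range_mono (by omega))
          fun _ _ _ => Finset.sum_nonneg fun _ _ => Finset.sum_nonneg fun _ _ => h0 _ _

end S13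

namespace S13

theorem time_pt (f f1 f2 l k : ℝ) (hl : l * k = 1) :
    1 / 2 * f1 ^ 2 - 3 / 2 * k ^ 2 * f ^ 2 - 3 / 2 * l ^ 2 * f2 ^ 2
      ≤ f1 * f1 + f * f2 - k * (f * f1) - l * (f1 * f2) := by
  have e1 : 0 ≤ k ^ 2 * f ^ 2 + 2 * (f * f2) + l ^ 2 * f2 ^ 2 := by
    have : k ^ 2 * f ^ 2 + 2 * (f * f2) + l ^ 2 * f2 ^ 2 = (k * f + l * f2) ^ 2 := by
      linear_combination (-(2 * f * f2)) * hl
    rw [this]; positivity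
  have e2 := sq_nonneg (f1 / 2 - k * f)
  have e3 := sq_nonneg (f1 / 2 - l * f2)
  nlinarith

theorem space_pt1 (a z y u u1 v l k : ℝ) (ha : 2 ≤ a) (hz : 0 ≤ z) (hz1 : z ≤ 1) (hy : y ^ 2 ≤ z)
    (hl : l * k = 1) (hk : 1 ≤ k) :
    1 / 2 * (z * u1 ^ 2) - ((3 + a) / 2 * k ^ 2 * u ^ 2 + 3 / 2 * l ^ 2 * v ^ 2)
      ≤ v * u + z * u1 ^ 2 - k / 2 * (a * u ^ 2 + 2 * z * u * u1) - l * y * u1 * v := by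
  have e1 : 0 ≤ k ^ 2 * u ^ 2 + 2 * (u * v) + l ^ 2 * v ^ 2 := by
    have : k ^ 2 * u ^ 2 + 2 * (u * v) + l ^ 2 * v ^ 2 = (k * u + l * v) ^ 2 := by
      linear_combination (-(2 * u * v)) * hl
    rw [this]; positivity
  have e2 := mul_nonneg hz (sq_nonneg (u1 / 2 - k * u))
  have e2' : z * (k ^ 2 * u ^ 2) ≤ k ^ 2 * u ^ 2 := mul_le_of_le_one_left (by positivity) hz1
  have e3 := sq_nonneg (y * u1 / 2 - l * v)
  have e3' : y ^ 2 * u1 ^ 2 ≤ z * u1 ^ 2 := by gcongr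
  have e4 : k * (a * u ^ 2) ≤ k ^ 2 * (a * u ^ 2) := by
    have : k ≤ k ^ 2 := by nlinarith
    gcongr
  nlinarith

theorem space_pt2 (a z y u1 v v1 l k : ℝ) (ha : 2 ≤ a) (hz : 0 ≤ z) (hz1 : z ≤ 1)
    (hy : y ^ 2 ≤ z) (hl : l * k = 1) (hk : 1 ≤ k) :
    1 / 2 * v ^ 2 - ((1 / 2 + 8 * a ^ 2) * k ^ 2 * (z * u1 ^ 2) + l ^ 2 * (z * v1 ^ 2))
      ≤ v ^ 2 + z * u1 * v1 - l / (2 * a) / 2 * (a * v ^ 2 + 2 * z * v * v1)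
        - 2 * a * k * y * u1 * v := by
  have hk0 : 0 < k := by linarith
  have hl0 : 0 < l := by nlinarith
  have hl1 : l ≤ 1 := by nlinarith
  have e1 : 0 ≤ z * (k ^ 2 * u1 ^ 2 + 2 * (u1 * v1) + l ^ 2 * v1 ^ 2) := by
    have : k ^ 2 * u1 ^ 2 + 2 * (u1 * v1) + l ^ 2 * v1 ^ 2 = (k * u1 + l * v1) ^ 2 := by
      linear_combination (-(2 * u1 * v1)) * hl
    rw [this]; positivity
  have e2 : l / (2 * a) / 2 * (a * v ^ 2) ≤ v ^ 2 / 4 := by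
    have : l / (2 * a) / 2 * (a * v ^ 2) = l * (v ^ 2 / 4) := by field_simp; ring
    rw [this]; exact mul_le_of_le_one_left (by positivity) hl1
  have e3 : l / (2 * a) / 2 * (2 * z * v * v1) ≤ v ^ 2 / 8 + 1 / 2 * (l ^ 2 * (z * v1 ^ 2)) := by
    set c := 1 / (2 * a) with hc
    have hc4 : c ≤ 1 / 4 := by rw [hc, div_le_div_iff₀ (by positivity) (by norm_num)]; linarith
    have hc0 : 0 ≤ c := by positivity
    have : l / (2 * a) / 2 * (2 * z * v * v1) = z * (c * l * v * v1) := by rw [hc]; field_simp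
    rw [this]
    have q := mul_nonneg hz (sq_nonneg (v / 4 - 2 * (c * l * v1)))
    have q2 : z * v ^ 2 ≤ v ^ 2 := mul_le_of_le_one_left (by positivity) hz1
    have q3 : c ^ 2 * (l ^ 2 * (z * v1 ^ 2)) ≤ (1 / 16) * (l ^ 2 * (z * v1 ^ 2)) := by
      have : c ^ 2 ≤ 1 / 16 := by nlinarith
      gcongr
    nlinarith [mul_nonneg hz (sq_nonneg v), mul_nonneg hz (sq_nonneg (l * v1))]
  have e4 : 2 * a * k * y * u1 * v ≤ v ^ 2 / 8 + 8 * a ^ 2 * k ^ 2 * (z * u1 ^ 2) := by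
    have q := sq_nonneg (v - 8 * a * k * y * u1)
    have q3 : 8 * a ^ 2 * k ^ 2 * (y ^ 2 * u1 ^ 2) ≤ 8 * a ^ 2 * k ^ 2 * (z * u1 ^ 2) := by
      gcongr
    nlinarith
  nlinarith

end S13

namespace S13

theorem weighted_of_deriv {N : ℝ} (hN : 4 ≤ N) (psi g X Y : ℝ → ℝ)
    (hp : Continuous psi) (hg : Continuous g) (hX : Continuous X) (hY : Continuous Y)
    (h01 : psi 1 ≤ psi 0)
    (hd : ∀ z ∈ Ioo (0:ℝ) 1, HasDerivAt psi (z ^ (N / 2 - 1) * g z) z)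
    (hle : ∀ z ∈ Icc (0:ℝ) 1, X z - Y z ≤ g z) :
    ∫ z in (0:ℝ)..1, X z * z ^ (N / 2 - 1) ≤ ∫ z in (0:ℝ)..1, Y z * z ^ (N / 2 - 1) := by
  have hw : Continuous fun z : ℝ => z ^ (N / 2 - 1) := Real.continuous_rpow_const (by linarith)
  have h1 := intervalIntegral.integral_eq_sub_of_hasDerivAt_of_le zero_le_one hp.continuousOn hd
    ((hw.mul hg).intervalIntegrable _ _)
  have h2 : ∫ z in (0:ℝ)..1, (X z * z ^ (N / 2 - 1) - Y z * z ^ (N / 2 - 1))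
      ≤ ∫ z in (0:ℝ)..1, z ^ (N / 2 - 1) * g z := by
    apply intervalIntegral.integral_mono_on zero_le_one
    · exact ((hX.mul hw).sub (hY.mul hw)).intervalIntegrable _ _
    · exact (hw.mul hg).intervalIntegrable _ _
    · intro z hz
      have := Real.rpow_nonneg hz.1 (N / 2 - 1)
      have := mul_le_mul_of_nonneg_left (hle z hz) this
      linarith
  have i1 : IntervalIntegrable (fun z => X z * z ^ (N / 2 - 1)) volume 0 1 :=
    (hX.mul hw).intervalIntegrable 0 1
  have i2 : IntervalIntegrable (fun z => Y z * z ^ (N / 2 - 1)) volume 0 1 :=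
    (hY.mul hw).intervalIntegrable 0 1
  rw [intervalIntegral.integral_sub i1 i2] at h2
  linarith

theorem rpow_facts {N : ℝ} (hN : 4 ≤ N) {z : ℝ} (hz : 0 ≤ z) (hz1 : z ≤ 1) :
    (z ^ (N / 2)) ^ 2 ≤ z := by
  rcases hz.eq_or_lt with rfl | h
  · rw [Real.zero_rpow (by linarith)]; norm_num
  · have : z ^ (N / 2) ≤ z ^ (1:ℝ) := Real.rpow_le_rpow_of_exponent_ge h hz1 (by linarith)
    rw [Real.rpow_one] at this
    have h0 := Real.rpow_nonneg hz (N / 2)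
    nlinarith

theorem space1 {N : ℝ} (hN : 4 ≤ N) (u u1 u2 : ℝ → ℝ) (h1 : ∀ z, HasDerivAt u (u1 z) z)
    (h2 : ∀ z, HasDerivAt u1 (u2 z) z) (hc : Continuous u2) (l k : ℝ) (hl : l * k = 1)
    (hk : 1 ≤ k) :
    sq N (fun z => Real.sqrt z * u1 z) ≤
      (3 + N / 2) * k ^ 2 * sq N u + 3 * l ^ 2 * sq N (fun z => z * u2 z + N / 2 * u1 z) := by
  have cu : Continuous u := continuous_iff_continuousAt.2 fun z => (h1 z).continuousAt
  have cu1 : Continuous u1 := continuous_iff_continuousAt.2 fun z => (h2 z).continuousAt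
  have hw : Continuous fun z : ℝ => z ^ (N / 2 - 1) := Real.continuous_rpow_const (by linarith)
  have hw2 : Continuous fun z : ℝ => z ^ (N / 2) := Real.continuous_rpow_const (by linarith)
  have main := weighted_of_deriv hN
    (fun z => z ^ (N / 2) * u1 z * u z - k / 2 * (z ^ (N / 2) * (u z) ^ 2)
      - l / 2 * (z ^ (N / 2) * u1 z) ^ 2)
    (fun z => (z * u2 z + N / 2 * u1 z) * u z + z * u1 z ^ 2
      - k / 2 * (N / 2 * u z ^ 2 + 2 * z * u z * u1 z)
      - l * z ^ (N / 2) * u1 z * (z * u2 z + N / 2 * u1 z))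
    (fun z => 1 / 2 * (z * u1 z ^ 2))
    (fun z => (3 + N / 2) / 2 * k ^ 2 * u z ^ 2 + 3 / 2 * l ^ 2 * (z * u2 z + N / 2 * u1 z) ^ 2)
    (by fun_prop) (by fun_prop) (by fun_prop) (by fun_prop) ?_ ?_ ?_
  · have e1 : sq N (fun z => Real.sqrt z * u1 z)
        = 2 * ∫ z in (0:ℝ)..1, 1 / 2 * (z * u1 z ^ 2) * z ^ (N / 2 - 1) := by
      rw [← intervalIntegral.integral_const_mul]
      apply intervalIntegral.integral_congr
      intro z hz
      rw [uIcc_of_le zero_le_one] at hz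
      simp only [mul_pow, Real.sq_sqrt hz.1]; ring
    have e2 : ∫ z in (0:ℝ)..1, ((3 + N / 2) / 2 * k ^ 2 * u z ^ 2
          + 3 / 2 * l ^ 2 * (z * u2 z + N / 2 * u1 z) ^ 2) * z ^ (N / 2 - 1)
        = (3 + N / 2) / 2 * k ^ 2 * sq N u
          + 3 / 2 * l ^ 2 * sq N (fun z => z * u2 z + N / 2 * u1 z) := by
      unfold sq
      rw [← intervalIntegral.integral_const_mul, ← intervalIntegral.integral_const_mul,
        ← intervalIntegral.integral_add]
      · congr 1; funext z; ring
      · apply Continuous.intervalIntegrable; fun_prop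
      · apply Continuous.intervalIntegrable; fun_prop
    rw [e2] at main
    rw [e1]; linarith
  · simp only [Real.one_rpow, Real.zero_rpow (show N / 2 ≠ 0 by linarith)]
    have hk0 : 0 < k := by linarith
    have : k / 2 * (u 1) ^ 2 + l / 2 * (u1 1) ^ 2 - u1 1 * u 1 = l / 2 * (u1 1 - k * u 1) ^ 2 := by
      linear_combination (u 1 * u1 1 - k * u 1 ^ 2 / 2) * hl
    have hl0 : 0 < l := by nlinarith
    have : 0 ≤ l / 2 * (u1 1 - k * u 1) ^ 2 := by positivity
    nlinarith
  · intro z hz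
    have hr : HasDerivAt (fun z : ℝ => z ^ (N / 2)) (N / 2 * z ^ (N / 2 - 1)) z :=
      Real.hasDerivAt_rpow_const (Or.inl hz.1.ne')
    have hzz : z ^ (N / 2) = z * z ^ (N / 2 - 1) := by
      rw [← Real.rpow_one_add' hz.1.le (by linarith)]; ring_nf
    have := ((((hr.mul (h2 z)).mul (h1 z)).sub ((hr.mul ((h1 z).pow 2)).const_mul (k / 2))).sub
      (((hr.mul (h2 z)).pow 2).const_mul (l / 2)))
    refine HasDerivAt.congr_deriv this ?_
    simp only [Pi.mul_apply, Pi.pow_apply, hzz]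
    push_cast; ring
  · intro z hz
    exact space_pt1 (N / 2) z (z ^ (N / 2)) (u z) (u1 z) (z * u2 z + N / 2 * u1 z) l k
      (by linarith) hz.1 hz.2 (rpow_facts hN hz.1 hz.2) hl hk

theorem space2 {N : ℝ} (hN : 4 ≤ N) (u1 u2 v v1 : ℝ → ℝ) (h2 : ∀ z, HasDerivAt u1 (u2 z) z)
    (hv : ∀ z, v z = z * u2 z + N / 2 * u1 z)
    (h3 : ∀ z, HasDerivAt v (v1 z) z) (hc : Continuous v1) (l k : ℝ) (hl : l * k = 1)
    (hk : 1 ≤ k) :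
    sq N v ≤ (1 + 4 * N ^ 2) * k ^ 2 * sq N (fun z => Real.sqrt z * u1 z)
      + 2 * l ^ 2 * sq N (fun z => Real.sqrt z * v1 z) := by
  have cu : Continuous v := continuous_iff_continuousAt.2 fun z => (h3 z).continuousAt
  have cu1 : Continuous u1 := continuous_iff_continuousAt.2 fun z => (h2 z).continuousAt
  have hw : Continuous fun z : ℝ => z ^ (N / 2 - 1) := Real.continuous_rpow_const (by linarith)
  have hw2 : Continuous fun z : ℝ => z ^ (N / 2) := Real.continuous_rpow_const (by linarith)
  have hk0 : 0 < k := by linarith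
  have hl0 : 0 < l := by nlinarith
  have main := weighted_of_deriv hN
    (fun z => z ^ (N / 2) * u1 z * v z - l / (2 * (N / 2)) / 2 * (z ^ (N / 2) * (v z) ^ 2)
      - (2 * (N / 2) * k) / 2 * (z ^ (N / 2) * u1 z) ^ 2)
    (fun z => v z ^ 2 + z * u1 z * v1 z
      - l / (2 * (N / 2)) / 2 * (N / 2 * v z ^ 2 + 2 * z * v z * v1 z)
      - 2 * (N / 2) * k * z ^ (N / 2) * u1 z * v z)
    (fun z => 1 / 2 * v z ^ 2)
    (fun z => (1 / 2 + 8 * (N / 2) ^ 2) * k ^ 2 * (z * u1 z ^ 2) + l ^ 2 * (z * v1 z ^ 2))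
    (by fun_prop) (by fun_prop) (by fun_prop) (by fun_prop) ?_ ?_ ?_
  · have e1 : sq N v = 2 * ∫ z in (0:ℝ)..1, 1 / 2 * v z ^ 2 * z ^ (N / 2 - 1) := by
      rw [← intervalIntegral.integral_const_mul]
      apply intervalIntegral.integral_congr
      intro z hz
      ring
    have e3 : ∀ f : ℝ → ℝ, sq N (fun z => Real.sqrt z * f z)
        = ∫ z in (0:ℝ)..1, (z * f z ^ 2) * z ^ (N / 2 - 1) := by
      intro f
      apply intervalIntegral.integral_congr
      intro z hz
      rw [uIcc_of_le zero_le_one] at hz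
      simp only [mul_pow, Real.sq_sqrt hz.1]
    have e2 : ∫ z in (0:ℝ)..1, ((1 / 2 + 8 * (N / 2) ^ 2) * k ^ 2 * (z * u1 z ^ 2)
          + l ^ 2 * (z * v1 z ^ 2)) * z ^ (N / 2 - 1)
        = (1 / 2 + 8 * (N / 2) ^ 2) * k ^ 2 * sq N (fun z => Real.sqrt z * u1 z)
          + l ^ 2 * sq N (fun z => Real.sqrt z * v1 z) := by
      rw [e3, e3]
      rw [← intervalIntegral.integral_const_mul, ← intervalIntegral.integral_const_mul,
        ← intervalIntegral.integral_add]
      · congr 1; funext z; ring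
      · apply Continuous.intervalIntegrable; fun_prop
      · apply Continuous.intervalIntegrable; fun_prop
    rw [e2] at main
    rw [e1]; linarith
  · simp only [Real.one_rpow, Real.zero_rpow (show N / 2 ≠ 0 by linarith)]
    have : l / (2 * (N / 2)) / 2 * (v 1) ^ 2 + (2 * (N / 2) * k) / 2 * (u1 1) ^ 2 - u1 1 * v 1
        = l / (2 * N) * (v 1 - N * k * u1 1) ^ 2 := by
      have : N ≠ 0 := by linarith
      field_simp
      linear_combination (2 * N * u1 1 * v 1 - N ^ 2 * k * u1 1 ^ 2) * hl
    have : 0 ≤ l / (2 * N) * (v 1 - N * k * u1 1) ^ 2 := by positivity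
    nlinarith
  · intro z hz
    have hr : HasDerivAt (fun z : ℝ => z ^ (N / 2)) (N / 2 * z ^ (N / 2 - 1)) z :=
      Real.hasDerivAt_rpow_const (Or.inl hz.1.ne')
    have hzz : z ^ (N / 2) = z * z ^ (N / 2 - 1) := by
      rw [← Real.rpow_one_add' hz.1.le (by linarith)]; ring_nf
    have := ((((hr.mul (h2 z)).mul (h3 z)).sub
      ((hr.mul ((h3 z).pow 2)).const_mul (l / (2 * (N / 2)) / 2))).sub
      (((hr.mul (h2 z)).pow 2).const_mul ((2 * (N / 2) * k) / 2)))
    refine HasDerivAt.congr_deriv this ?_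
    simp only [Pi.mul_apply, Pi.pow_apply, hzz]
    have hvz := hv z
    have : z * u2 z = v z - N / 2 * u1 z := by linarith
    push_cast
    linear_combination (z ^ (N / 2 - 1) * v z
      - 2 * (N / 2) * k * z * (z ^ (N / 2 - 1)) ^ 2 * u1 z) * this
  · intro z hz
    exact space_pt2 (N / 2) z (z ^ (N / 2)) (u1 z) (v z) (v1 z) l k
      (by linarith) hz.1 hz.2 (rpow_facts hN hz.1 hz.2) hl hk

end S13

namespace S13

theorem swap_int {T : ℝ} (hT : 0 < T) {F : ℝ → ℝ → ℝ} (h : Co F) :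
    ∫ t in (0:ℝ)..T, ∫ z in (0:ℝ)..1, F t z = ∫ z in (0:ℝ)..1, ∫ t in (0:ℝ)..T, F t z := by
  simp only [intervalIntegral.integral_of_le hT.le, intervalIntegral.integral_of_le zero_le_one]
  apply integral_integral_swap
  rw [Measure.prod_restrict]
  have hc : Continuous (Function.uncurry F) := h
  have : IntegrableOn (Function.uncurry F) (Icc 0 T ×ˢ Icc 0 1) (volume.prod volume) :=
    hc.continuousOn.integrableOn_compact (isCompact_Icc.prod isCompact_Icc)
  exact this.mono_set (prod_mono Ioc_subset_Icc_self Ioc_subset_Icc_self)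

theorem time1 {N T : ℝ} (hN : 4 ≤ N) (hT : 0 < T) (F F1 F2 : ℝ → ℝ → ℝ)
    (c0 : Co F) (c1 : Co F1) (c2 : Co F2)
    (h1 : ∀ t z, HasDerivAt (fun s => F s z) (F1 t z) t)
    (h2 : ∀ t z, HasDerivAt (fun s => F1 s z) (F2 t z) t)
    (z0 : ∀ z, F 0 z = 0) (z1 : ∀ z, F1 0 z = 0) (l k : ℝ) (hl : l * k = 1)
    (hk : 1 ≤ k) :
    dbl N T F1 ≤ 3 * k ^ 2 * dbl N T F + 3 * l ^ 2 * dbl N T F2 := by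
  have hl0 : 0 < l := by nlinarith
  have hw := Co.zw hN
  set g : ℝ → ℝ → ℝ := fun t z => F1 t z * F1 t z + F t z * F2 t z - k * (F t z * F1 t z)
    - l * (F1 t z * F2 t z) with hg
  have cg : Co g := (((c1.mul c1).add (c0.mul c2)).sub ((c0.mul c1).smul k)).sub
    ((c1.mul c2).smul l)
  have cgw : Co (fun t z => g t z * z ^ (N / 2 - 1)) := cg.mul hw
  have hneg : ∫ t in (0:ℝ)..T, ∫ z in (0:ℝ)..1, g t z * z ^ (N / 2 - 1) ≤ 0 := by
    rw [swap_int hT cgw]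
    have : ∀ z ∈ Icc (0:ℝ) 1, ∫ t in (0:ℝ)..T, g t z * z ^ (N / 2 - 1) ≤ 0 := by
      intro z hz
      rw [intervalIntegral.integral_mul_const]
      apply mul_nonpos_of_nonpos_of_nonneg _ (Real.rpow_nonneg hz.1 _)
      have := intervalIntegral.integral_eq_sub_of_hasDerivAt (a := 0) (b := T)
        (f := fun t => F t z * F1 t z - k / 2 * (F t z) ^ 2 - l / 2 * (F1 t z) ^ 2)
        (f' := fun t => g t z) (fun t _ => by
          have := (((h1 t z).mul (h2 t z)).sub (((h1 t z).pow 2).const_mul (k / 2))).sub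
            (((h2 t z).pow 2).const_mul (l / 2))
          refine HasDerivAt.congr_deriv this ?_
          simp only [hg]; push_cast; ring) ((cg.slt z).intervalIntegrable _ _)
      rw [this, z0, z1]
      have e : k / 2 * (F T z) ^ 2 + l / 2 * (F1 T z) ^ 2 - F T z * F1 T z
          = l / 2 * (F1 T z - k * F T z) ^ 2 := by
        linear_combination (F T z * F1 T z - k * F T z ^ 2 / 2) * hl
      have : 0 ≤ l / 2 * (F1 T z - k * F T z) ^ 2 := by positivity
      nlinarith
    have h0 : ∫ z in (0:ℝ)..1, ∫ t in (0:ℝ)..T, g t z * z ^ (N / 2 - 1)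
        = - ∫ z in (0:ℝ)..1, - ∫ t in (0:ℝ)..T, g t z * z ^ (N / 2 - 1) := by
      rw [intervalIntegral.integral_neg, neg_neg]
    rw [h0]
    have : 0 ≤ ∫ z in (0:ℝ)..1, - ∫ t in (0:ℝ)..T, g t z * z ^ (N / 2 - 1) :=
      intervalIntegral.integral_nonneg zero_le_one fun z hz => by
        have := this z hz; linarith
    linarith
  have hge : ∫ t in (0:ℝ)..T, (1 / 2 * sq N (F1 t) - (3 / 2 * k ^ 2 * sq N (F t)
      + 3 / 2 * l ^ 2 * sq N (F2 t))) ≤ ∫ t in (0:ℝ)..T, ∫ z in (0:ℝ)..1, g t z * z ^ (N / 2 - 1) := by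
    have s0 := sq_cont hN c0
    have s1 := sq_cont hN c1
    have s2 := sq_cont hN c2
    apply intervalIntegral.integral_mono_on hT.le
    · apply Continuous.intervalIntegrable; fun_prop
    · apply Continuous.intervalIntegrable
      have cgw' : Continuous (Function.uncurry fun t z => g t z * z ^ (N / 2 - 1)) := cgw
      exact intervalIntegral.continuous_parametric_intervalIntegral_of_continuous' cgw' 0 1
    · intro t ht
      have i0 : IntervalIntegrable (fun z => F t z ^ 2 * z ^ (N / 2 - 1)) volume 0 1 :=
        ((c0.sqw hN).sl t).intervalIntegrable 0 1
      have i1 : IntervalIntegrable (fun z => F1 t z ^ 2 * z ^ (N / 2 - 1)) volume 0 1 :=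
        ((c1.sqw hN).sl t).intervalIntegrable 0 1
      have i2 : IntervalIntegrable (fun z => F2 t z ^ 2 * z ^ (N / 2 - 1)) volume 0 1 :=
        ((c2.sqw hN).sl t).intervalIntegrable 0 1
      unfold sq
      rw [← intervalIntegral.integral_const_mul, ← intervalIntegral.integral_const_mul,
        ← intervalIntegral.integral_const_mul,
        ← intervalIntegral.integral_add (i0.const_mul _) (i2.const_mul _),
        ← intervalIntegral.integral_sub (i1.const_mul _) ((i0.const_mul _).add (i2.const_mul _))]
      apply intervalIntegral.integral_mono_on zero_le_one
      · exact (i1.const_mul _).sub ((i0.const_mul _).add (i2.const_mul _))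
      · exact (cgw.sl t).intervalIntegrable _ _
      · intro z hz
        have hp := time_pt (F t z) (F1 t z) (F2 t z) l k hl
        have := mul_le_mul_of_nonneg_right hp (Real.rpow_nonneg hz.1 (N / 2 - 1))
        simp only [hg]
        linarith
  have s0 : IntervalIntegrable (fun t => sq N (F t)) volume 0 T :=
    (sq_cont hN c0).intervalIntegrable 0 T
  have s1 : IntervalIntegrable (fun t => sq N (F1 t)) volume 0 T :=
    (sq_cont hN c1).intervalIntegrable 0 T
  have s2 : IntervalIntegrable (fun t => sq N (F2 t)) volume 0 T :=
    (sq_cont hN c2).intervalIntegrable 0 T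
  rw [intervalIntegral.integral_sub (s1.const_mul _) ((s0.const_mul _).add (s2.const_mul _)),
    intervalIntegral.integral_add (s0.const_mul _) (s2.const_mul _),
    intervalIntegral.integral_const_mul, intervalIntegral.integral_const_mul,
    intervalIntegral.integral_const_mul] at hge
  unfold dbl
  linarith

theorem dbl_lin {N T : ℝ} (hN : 4 ≤ N) (hT : 0 < T) {F G K : ℝ → ℝ → ℝ} (c0 : Co F) (c1 : Co G)
    (c2 : Co K) (a b : ℝ) (h : ∀ t, sq N (F t) ≤ a * sq N (G t) + b * sq N (K t)) :
    dbl N T F ≤ a * dbl N T G + b * dbl N T K := by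
  have s1 : IntervalIntegrable (fun t => sq N (G t)) volume 0 T :=
    (sq_cont hN c1).intervalIntegrable 0 T
  have s2 : IntervalIntegrable (fun t => sq N (K t)) volume 0 T :=
    (sq_cont hN c2).intervalIntegrable 0 T
  unfold dbl
  rw [← intervalIntegral.integral_const_mul, ← intervalIntegral.integral_const_mul,
    ← intervalIntegral.integral_add (s1.const_mul _) (s2.const_mul _)]
  apply intervalIntegral.integral_mono_on hT.le
  · exact (sq_cont hN c0).intervalIntegrable 0 T
  · exact (s1.const_mul _).add (s2.const_mul _)
  · intro t _; exact h t

theorem space_grad {N T : ℝ} (hN : 4 ≤ N) (hT : 0 < T) {F} (h : Sm F) (q : ℕ) (l k : ℝ)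
    (hl : l * k = 1) (hk : 1 ≤ k) :
    dbl N T (grad N (q + 1) F) ≤ (3 + 4 * N ^ 2) * k ^ 2 * dbl N T (grad N q F)
      + (3 + 4 * N ^ 2) * l ^ 2 * dbl N T (grad N (q + 2) F) := by
  have hk0 : 0 < k := by linarith
  rcases Nat.even_or_odd' q with ⟨m, rfl | rfl⟩
  · have hs := h.delT_iter N m
    have := dbl_lin hN hT (h.grad_co N (2 * m + 1)) (h.grad_co N (2 * m))
      (h.grad_co N (2 * m + 2)) ((3 + N / 2) * k ^ 2) (3 * l ^ 2) (T := T) (by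
        intro t
        rw [grad_even, grad_odd, show 2 * m + 2 = 2 * (m + 1) by ring, grad_even,
          Function.iterate_succ_apply']
        exact space1 hN _ _ _ (hs.hz t) (hs.dz.hz t) (hs.dz.dz.co.sl t) l k hl hk)
    refine this.trans ?_
    have a1 := dbl_nonneg (N := N) hT (grad N (2 * m) F)
    have a2 := dbl_nonneg (N := N) hT (grad N (2 * m + 2) F)
    gcongr <;> nlinarith
  · have hs := h.delT_iter N m
    have hs2 := hs.delT N
    have := dbl_lin hN hT (h.grad_co N (2 * m + 1 + 1)) (h.grad_co N (2 * m + 1))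
      (h.grad_co N (2 * m + 1 + 2)) ((1 + 4 * N ^ 2) * k ^ 2) (2 * l ^ 2) (T := T) (by
        intro t
        rw [grad_odd, show 2 * m + 1 + 1 = 2 * (m + 1) by ring, grad_even,
          show 2 * m + 1 + 2 = 2 * (m + 1) + 1 by ring, grad_odd,
          Function.iterate_succ_apply']
        exact space2 hN _ _ _ _ (hs.dz.hz t) (fun z => rfl) (hs2.hz t) (hs2.dz.co.sl t) l k hl hk)
    refine this.trans ?_
    have a1 := dbl_nonneg (N := N) hT (grad N (2 * m + 1) F)
    have a2 := dbl_nonneg (N := N) hT (grad N (2 * m + 1 + 2) F)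
    gcongr <;> nlinarith

theorem grad_ht {F} (N : ℝ) (q : ℕ) (h : Sm F) (t z : ℝ) :
    HasDerivAt (fun s => grad N q F s z) (grad N q (dt F) t z) t := by
  unfold grad
  split_ifs
  · rw [← dt_delT_iter N h]; exact (h.delT_iter N _).ht t z
  · rw [← dt_delT_iter N h, ← dt_dz (h.delT_iter N _)]
    exact ((h.delT_iter N _).dz.ht t z).const_mul _

theorem vanish_dt {F} (h : Sm F) {τ : ℝ} (hτ : 0 < τ) (h0 : ∀ t ∈ Icc (0:ℝ) τ, ∀ z, F t z = 0) :
    ∀ t ∈ Icc (0:ℝ) τ, ∀ z, dt F t z = 0 := by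
  intro t ht z
  have hc : Continuous (fun t => dt F t z) := h.dt.co.slt z
  have hcl : IsClosed {t | dt F t z = 0} := isClosed_eq hc continuous_const
  have hsub : Ioo 0 τ ⊆ {t | dt F t z = 0} := by
    intro s hs
    have : (fun s => F s z) =ᶠ[nhds s] fun _ => 0 := by
      filter_upwards [isOpen_Ioo.mem_nhds hs] with r hr
      exact h0 r ⟨hr.1.le, hr.2.le⟩ z
    have := this.deriv_eq
    rw [deriv_const] at this
    exact this
  have := closure_minimal hsub hcl
  rw [closure_Ioo hτ.ne] at this
  exact this ht

theorem vanish_iter {F} (h : Sm F) {τ : ℝ} (hτ : 0 < τ) (h0 : ∀ t ∈ Icc (0:ℝ) τ, ∀ z, F t z = 0)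
    (j : ℕ) : ∀ t ∈ Icc (0:ℝ) τ, ∀ z, dt^[j] F t z = 0 := by
  induction j with
  | zero => exact h0
  | succ j ih => rw [Function.iterate_succ_apply']; exact vanish_dt (h.dt_iter j) hτ ih

theorem delT_zero_at {N : ℝ} {F : ℝ → ℝ → ℝ} {t : ℝ} (h : ∀ z, F t z = 0) (m : ℕ) :
    ∀ z, (delT N)^[m] F t z = 0 := by
  induction m with
  | zero => exact h
  | succ m ih =>
    rw [Function.iterate_succ_apply']
    intro z
    have : (delT N)^[m] F t = fun _ => 0 := funext ih
    simp [delT, Del, this]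

theorem grad_zero_at {N : ℝ} {F : ℝ → ℝ → ℝ} {t : ℝ} (h : ∀ z, F t z = 0) (q : ℕ) (z : ℝ) :
    grad N q F t z = 0 := by
  unfold grad; split_ifs
  · exact delT_zero_at h _ z
  · have : (delT N)^[q / 2] F t = fun _ => 0 := funext (delT_zero_at h _)
    simp [dz, this]

theorem hsq_interp {N T : ℝ} (hN : 4 ≤ N) (hT : 0 < T) {F} (h : Sm F) {τ : ℝ} (hτ : 0 < τ)
    (h0 : ∀ t ∈ Icc (0:ℝ) τ, ∀ z, F t z = 0) (n : ℕ) (e : ℝ) (he : 0 < e) (he1 : e ≤ 1) :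
    hsq N T (n + 1) F ≤ ((n + 2 : ℕ) : ℝ) ^ 3 * (3 + 4 * N ^ 2) *
      (hsq N T n F / e + e * hsq N T (n + 2) F) := by
  have hA := hsq_nonneg N T n F
  have hB := hsq_nonneg N T (n + 2) F
  have hs0 : 0 < Real.sqrt e := Real.sqrt_pos.2 he
  have hs1 : Real.sqrt e ≤ 1 := Real.sqrt_le_one.2 he1
  have hl : Real.sqrt e * (1 / Real.sqrt e) = 1 := by field_simp
  have hk : 1 ≤ 1 / Real.sqrt e := by rw [le_div_iff₀ hs0]; linarith
  have hl2 : (Real.sqrt e) ^ 2 = e := Real.sq_sqrt he.le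
  have hk2 : (1 / Real.sqrt e) ^ 2 = 1 / e := by rw [div_pow, hl2]; norm_num
  rw [mul_assoc]
  apply hsq_le hN hT (n + 1) h
  · positivity
  intro j l hjl
  by_cases hlt : j + l ≤ n
  · calc _ ≤ hsq N T n F := dbl_le_hsq hN hT hlt h
      _ ≤ hsq N T n F / e := by rw [le_div_iff₀ he]; nlinarith
      _ ≤ hsq N T n F / e + e * hsq N T (n + 2) F := by
        have : 0 ≤ e * hsq N T (n + 2) F := by positivity
        linarith
      _ ≤ _ := le_mul_of_one_le_left (by positivity) (by nlinarith)
  have key : ∀ A B C K : ℝ, 0 ≤ A → 0 ≤ B → 0 ≤ K → K ≤ 3 + 4 * N ^ 2 → A ≤ hsq N T n F →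
      B ≤ hsq N T (n + 2) F → C ≤ K * (1 / Real.sqrt e) ^ 2 * A + K * (Real.sqrt e) ^ 2 * B →
      C ≤ (3 + 4 * N ^ 2) * (hsq N T n F / e + e * hsq N T (n + 2) F) := by
    intro A B C K hA' hB' hK hKN hAA hBB hC
    rw [hl2, hk2] at hC
    calc C ≤ _ := hC
      _ = K * (A / e + e * B) := by ring
      _ ≤ _ := by gcongr
  rcases Nat.eq_zero_or_pos j with rfl | hj
  · obtain ⟨q, rfl⟩ : ∃ q, l = q + 1 := ⟨l - 1, by omega⟩
    refine key _ _ _ (3 + 4 * N ^ 2) (dbl_nonneg hT _) (dbl_nonneg hT _) (by positivity) le_rfl ?_ ?_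
      (space_grad hN hT h q _ _ hl hk)
    · exact dbl_le_hsq (j := 0) hN hT (by omega) h
    · exact dbl_le_hsq (j := 0) hN hT (by omega) h
  · obtain ⟨i, rfl⟩ : ∃ i, j = i + 1 := ⟨j - 1, by omega⟩
    have hi := h.dt_iter i
    have z0 : ∀ k z, dt^[k] F 0 z = 0 := fun k z =>
      vanish_iter h hτ h0 k 0 ⟨le_rfl, hτ.le⟩ z
    have e1 : dt^[i + 1] F = dt (dt^[i] F) := Function.iterate_succ_apply' _ _ _
    have e2 : dt^[i + 2] F = dt (dt^[i + 1] F) := Function.iterate_succ_apply' _ _ _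
    refine key (dbl N T (grad N l (dt^[i] F))) (dbl N T (grad N l (dt^[i + 2] F))) _ 3
      (dbl_nonneg hT _) (dbl_nonneg hT _) (by norm_num) (by nlinarith) ?_ ?_ ?_
    · exact dbl_le_hsq hN hT (by omega) h
    · exact dbl_le_hsq hN hT (by omega) h
    · apply time1 hN hT _ _ _ (hi.grad_co N l) ((h.dt_iter _).grad_co N l)
        ((h.dt_iter _).grad_co N l)
      · intro t z; rw [e1]; exact grad_ht N l hi t z
      · intro t z; rw [e2]; exact grad_ht N l (h.dt_iter _) t z
      · intro z; exact grad_zero_at (z0 i) l z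
      · intro z; exact grad_zero_at (z0 (i + 1)) l z
      · exact hl
      · exact hk

/-- From additive to multiplicative interpolation. -/
theorem mult_of_add {X Y W K : ℝ} (hX : 0 ≤ X) (hY : 0 ≤ Y) (hYW : Y ≤ W) (hK : 0 ≤ K)
    (h : ∀ e : ℝ, 0 < e → e ≤ 1 → X ≤ K * (Y / e + e * W)) : X ^ 2 ≤ 4 * K ^ 2 * (Y * W) := by
  have hf : ∀ d > 0, X ^ 2 ≤ 4 * K ^ 2 * ((Y + d) * (W + d)) := by
    intro d hd
    have p1 : 0 < Y + d := by linarith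
    have p2 : 0 < W + d := by linarith
    set s := Real.sqrt ((Y + d) / (W + d)) with hs
    have hs2 : s ^ 2 = (Y + d) / (W + d) := Real.sq_sqrt (by positivity)
    have hs0 : 0 < s := Real.sqrt_pos.2 (by positivity)
    have hs1 : s ≤ 1 := Real.sqrt_le_one.2 (by rw [div_le_one p2]; linarith)
    have h1 := h s hs0 hs1
    have h2 : K * (Y / s + s * W) ≤ K * ((Y + d) / s + s * (W + d)) := by gcongr <;> linarith
    have h3 : (Y + d) / s = s * (W + d) := by
      rw [div_eq_iff hs0.ne']
      have : s * (W + d) * s = s ^ 2 * (W + d) := by ring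
      rw [this, hs2]; field_simp
    rw [h3] at h2
    have h4 : X ≤ 2 * K * (s * (W + d)) := by linarith
    calc X ^ 2 ≤ (2 * K * (s * (W + d))) ^ 2 := by gcongr
      _ = 4 * K ^ 2 * (s ^ 2 * (W + d) ^ 2) := by ring
      _ = _ := by rw [hs2]; field_simp
  have hlim : Filter.Tendsto (fun d : ℝ => 4 * K ^ 2 * ((Y + d) * (W + d)))
      (nhdsWithin 0 (Ioi 0)) (nhds (4 * K ^ 2 * ((Y + 0) * (W + 0)))) := by
    apply Filter.Tendsto.mono_left _ nhdsWithin_le_nhds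
    apply Continuous.tendsto; fun_prop
  have := ge_of_tendsto hlim (by
    filter_upwards [self_mem_nhdsWithin] with d hd using hf d hd)
  simpa using this

/-- Discrete maximum principle for almost log-convex sequences. -/
theorem disc_max (c : ℕ → ℝ) (S : ℕ) (L : ℝ) (hL : 1 ≤ L) (hc : ∀ s, 0 ≤ c s)
    (h : ∀ s, s + 2 ≤ S → c (s + 1) ^ 2 ≤ L * (c s * c (s + 2))) (s : ℕ) (hs : s ≤ S) :
    c s ≤ L ^ (S * S) * max (c 0) (c S) := by
  have hL0 : 0 < L := by linarith
  set d : ℕ → ℝ := fun s => c s / L ^ (s * (S - s)) with hd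
  have hd0 : ∀ s, 0 ≤ d s := fun s => div_nonneg (hc s) (by positivity)
  have hlc : ∀ s, s + 2 ≤ S → d (s + 1) ^ 2 ≤ d s * d (s + 2) := by
    intro s hs
    obtain ⟨r, rfl⟩ := Nat.exists_eq_add_of_le hs
    simp only [hd]
    rw [show s + 2 + r - (s + 1) = r + 1 by omega, show s + 2 + r - s = r + 2 by omega,
      show s + 2 + r - (s + 2) = r by omega, div_pow, div_mul_div_comm,
      div_le_div_iff₀ (by positivity) (by positivity), ← pow_mul, ← pow_add]
    have e : (s + 1) * (r + 1) * 2 = (s * (r + 2) + (s + 2) * r) + 2 := by ring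
    have hp : L ^ ((s + 1) * (r + 1) * 2) = L ^ (s * (r + 2) + (s + 2) * r) * L ^ 2 := by
      rw [e, pow_add]
    rw [hp]
    calc c (s + 1) ^ 2 * L ^ (s * (r + 2) + (s + 2) * r)
        ≤ L * (c s * c (s + 2)) * L ^ (s * (r + 2) + (s + 2) * r) := by
          gcongr; exact h s hs
      _ ≤ L ^ 2 * (c s * c (s + 2)) * L ^ (s * (r + 2) + (s + 2) * r) := by
          have := mul_nonneg (hc s) (hc (s + 2))
          gcongr; nlinarith
      _ = _ := by ring
  have hmax : ∀ s ≤ S, d s ≤ max (d 0) (d S) := by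
    by_contra hcon
    push Not at hcon
    obtain ⟨m, hm, hmm⟩ := Finset.exists_max_image (Finset.range (S + 1)) d ⟨0, by simp⟩
    -- least index attaining the maximum
    have hex : ∃ m, m ≤ S ∧ ∀ r ≤ S, d r ≤ d m :=
      ⟨m, by simpa [Nat.lt_succ_iff] using hm, fun r hr => hmm r (by simpa [Nat.lt_succ_iff] using hr)⟩
    classical
    have hsp := Nat.find_spec hex
    have hmin : ∀ k < Nat.find hex, ¬ _ := fun k hk => Nat.find_min hex hk
    set i := Nat.find hex with hi
    obtain ⟨r, hr, hrr⟩ := hcon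
    have hgt : max (d 0) (d S) < d i := hrr.trans_le (hsp.2 r hr)
    have hi0 : i ≠ 0 := by rintro h0; rw [h0] at hgt; exact absurd (le_max_left _ _) (not_le.2 hgt)
    have hiS : i ≠ S := by rintro h0; rw [h0] at hgt; exact absurd (le_max_right _ _) (not_le.2 hgt)
    obtain ⟨p, hp⟩ : ∃ p, i = p + 1 := ⟨i - 1, by omega⟩
    have hpS : p + 2 ≤ S := by have := hsp.1; omega
    have h1 := hlc p hpS
    rw [← hp] at h1
    have h2 := hsp.2 (p + 2) hpS
    have hpos : 0 < d i := lt_of_le_of_lt (le_trans (hd0 0) (le_max_left _ _)) hgt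
    have h3 : d i ≤ d p := by
      by_contra hlt
      push Not at hlt
      have : d p * d (p + 2) ≤ d p * d i := mul_le_mul_of_nonneg_left h2 (hd0 p)
      nlinarith
    exact hmin p (by omega) ⟨by omega, fun r hr => (hsp.2 r hr).trans h3⟩
  have h1 := hmax s hs
  have e0 : d 0 = c 0 := by simp [hd]
  have eS : d S = c S := by simp [hd]
  rw [e0, eS] at h1
  simp only [hd] at h1
  rw [div_le_iff₀ (by positivity), mul_comm] at h1
  refine h1.trans ?_
  have : 0 ≤ max (c 0) (c S) := le_max_of_le_left (hc 0)
  gcongr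
  exact Nat.sub_le _ _

end S13

namespace S13

/-- Change of variables `z = r²/4`. -/
noncomputable def sb (F : ℝ → ℝ → ℝ) : ℝ → ℝ → ℝ := fun t r => F t (r ^ 2 / 4)

theorem Sm.sb {F} (h : Sm F) : Sm (sb F) := by
  have h2 : ContDiff ℝ (⊤ : ℕ∞) (fun p : ℝ × ℝ => (p.1, p.2 ^ 2 / 4)) := by fun_prop
  exact ContDiff.comp (g := fun p : ℝ × ℝ => F p.1 p.2) h h2

theorem dt_sb (F) : dt (sb F) = sb (dt F) := rfl

theorem dt_iter_sb (F) (j : ℕ) : dt^[j] (sb F) = sb (dt^[j] F) := by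
  induction j with
  | zero => rfl
  | succ j ih => rw [Function.iterate_succ_apply', Function.iterate_succ_apply', ih]; rfl

theorem Ddot_sb {F} (h : Sm F) (t : ℝ) (k : ℕ) : ∀ z : ℝ, 0 < z →
    Ddot^[k] (F t) z = dz^[k] (sb F) t (2 * Real.sqrt z) := by
  induction k with
  | zero =>
    intro z hz
    simp only [Function.iterate_zero, id, sb]
    rw [mul_pow, Real.sq_sqrt hz.le]; congr 1; ring
  | succ k ih =>
    intro z hz
    rw [Function.iterate_succ_apply', Function.iterate_succ_apply']
    have he : Ddot^[k] (F t) =ᶠ[nhds z] fun w => dz^[k] (sb F) t (2 * Real.sqrt w) := by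
      filter_upwards [isOpen_Ioi.mem_nhds hz] with w hw using ih w hw
    have hd : HasDerivAt (fun w => dz^[k] (sb F) t (2 * Real.sqrt w))
        (dz (dz^[k] (sb F)) t (2 * Real.sqrt z) * (2 * (1 / (2 * Real.sqrt z)))) z :=
      ((h.sb.dz_iter k).hz t (2 * Real.sqrt z)).comp z
        ((Real.hasDerivAt_sqrt hz.ne').const_mul 2)
    show Real.sqrt z * deriv _ z = _
    rw [he.deriv_eq, hd.deriv]
    have : 0 < Real.sqrt z := Real.sqrt_pos.2 hz
    field_simp

theorem Ddot_zero (f : ℝ → ℝ) (k : ℕ) (hk : 1 ≤ k) : Ddot^[k] f 0 = 0 := by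
  obtain ⟨k, rfl⟩ : ∃ i, k = i + 1 := ⟨k - 1, by omega⟩
  rw [Function.iterate_succ_apply']; simp [Ddot]

/-- Bounds in the `r` variable. -/
def Bd (T : ℝ) (m : ℕ) (F : ℝ → ℝ → ℝ) (K : ℝ) : Prop :=
  ∀ j k, j + k ≤ m → ∀ t ∈ Icc (0:ℝ) T, ∀ r ∈ Icc (0:ℝ) 2, |dz^[k] (dt^[j] (sb F)) t r| ≤ K

theorem Bd.pt {T : ℝ} {m : ℕ} {F K} (h : Sm F) (hb : Bd T m F K) (hK : 0 ≤ K) {j k : ℕ}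
    (hjk : j + k ≤ m) {t z : ℝ} (ht : t ∈ Icc (0:ℝ) T) (hz : z ∈ Icc (0:ℝ) 1) :
    |Ddot^[k] (dt^[j] F t) z| ≤ K := by
  rcases hz.1.eq_or_lt with h0 | h0
  · subst h0
    rcases Nat.eq_zero_or_pos k with rfl | hk
    · have := hb j 0 hjk t ht 0 ⟨le_rfl, by norm_num⟩
      rw [dt_iter_sb] at this
      simpa [sb] using this
    · rw [Ddot_zero _ _ hk]; simpa
  · rw [Ddot_sb (h.dt_iter j) t k z h0, ← dt_iter_sb]
    apply hb j k hjk t ht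
    have : Real.sqrt z ≤ 1 := Real.sqrt_le_one.2 hz.2
    exact ⟨by positivity, by linarith⟩

theorem exists_Bd {T : ℝ} (m : ℕ) {F} (h : Sm F) : ∃ K, 0 ≤ K ∧ Bd T m F K := by
  have hb : ∀ p : ℕ × ℕ, ∃ K, ∀ t ∈ Icc (0:ℝ) T, ∀ r ∈ Icc (0:ℝ) 2,
      |dz^[p.2] (dt^[p.1] (sb F)) t r| ≤ K := by
    intro p
    have hc : Continuous (fun q : ℝ × ℝ => dz^[p.2] (dt^[p.1] (sb F)) q.1 q.2) :=
      ((h.sb.dt_iter p.1).dz_iter p.2).co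
    obtain ⟨K, hK⟩ := (isCompact_Icc.prod isCompact_Icc :
      IsCompact (Icc (0:ℝ) T ×ˢ Icc (0:ℝ) 2)).exists_bound_of_continuousOn hc.continuousOn
    exact ⟨K, fun t ht r hr => hK (t, r) ⟨ht, hr⟩⟩
  choose K hK using hb
  refine ⟨∑ p ∈ Finset.range (m + 1) ×ˢ Finset.range (m + 1), |K p|,
    Finset.sum_nonneg fun _ _ => abs_nonneg _, ?_⟩
  intro j k hjk t ht r hr
  refine (hK (j, k) t ht r hr).trans ((le_abs_self _).trans ?_)
  apply Finset.single_le_sum (f := fun p => |K p|) (fun _ _ => abs_nonneg _)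
  simp; omega

theorem supNT_le {T : ℝ} {m : ℕ} {F K} (h : Sm F) (hb : Bd T m F K) (hK : 0 ≤ K) :
    supNT T m F ≤ K := by
  apply Real.iSup_le _ hK
  rintro ⟨⟨j, k⟩, hjk⟩
  apply Real.iSup_le _ hK
  intro t
  apply Real.iSup_le _ hK
  intro z
  exact hb.pt h hK hjk t.2 z.2

theorem pt_le {T : ℝ} {m : ℕ} {F} (h : Sm F) {j k : ℕ}
    (hjk : j + k ≤ m) {t z : ℝ} (ht : t ∈ Icc (0:ℝ) T) (hz : z ∈ Icc (0:ℝ) 1) :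
    |Ddot^[k] (dt^[j] F t) z| ≤ supNT T m F := by
  obtain ⟨K, hK, hb⟩ := exists_Bd (T := T) m h
  have p : ∀ (j k : ℕ), j + k ≤ m → ∀ t : Icc (0:ℝ) T,
      (⨆ z : Icc (0:ℝ) 1, |Ddot^[k] (dt^[j] F t.1) z.1|) ≤ K := fun j k hjk t =>
    Real.iSup_le (fun z => hb.pt h hK hjk t.2 z.2) hK
  have q : ∀ p : {p : ℕ × ℕ // p.1 + p.2 ≤ m},
      supT T (fun t => Ddot^[p.1.2] (dt^[p.1.1] F t)) ≤ K := fun pp =>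
    Real.iSup_le (fun t => p _ _ pp.2 t) hK
  have h1 : |Ddot^[k] (dt^[j] F t) z| ≤ ⨆ z : Icc (0:ℝ) 1, |Ddot^[k] (dt^[j] F t) z.1| :=
    le_ciSup (f := fun z : Icc (0:ℝ) 1 => |Ddot^[k] (dt^[j] F t) z.1|)
      ⟨K, by rintro _ ⟨z, rfl⟩; exact hb.pt h hK hjk ht z.2⟩ ⟨z, hz⟩
  have h2 : (⨆ z : Icc (0:ℝ) 1, |Ddot^[k] (dt^[j] F t) z.1|)
      ≤ supT T (fun t => Ddot^[k] (dt^[j] F t)) :=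
    le_ciSup (f := fun t : Icc (0:ℝ) T => ⨆ z : Icc (0:ℝ) 1, |Ddot^[k] (dt^[j] F t.1) z.1|)
      ⟨K, by rintro _ ⟨t, rfl⟩; exact p j k hjk t⟩ ⟨t, ht⟩
  have h3 : supT T (fun t => Ddot^[k] (dt^[j] F t)) ≤ supNT T m F :=
    le_ciSup (f := fun p : {p : ℕ × ℕ // p.1 + p.2 ≤ m} =>
      supT T (fun t => Ddot^[p.1.2] (dt^[p.1.1] F t)))
      ⟨K, by rintro _ ⟨t, rfl⟩; exact q t⟩ ⟨(j, k), hjk⟩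
  exact h1.trans (h2.trans h3)

theorem supNT_nonneg (T : ℝ) (m : ℕ) (F) : 0 ≤ supNT T m F :=
  Real.iSup_nonneg fun _ => Real.iSup_nonneg fun _ => Real.iSup_nonneg fun _ => abs_nonneg _

theorem supNT_Bd {T : ℝ} (m : ℕ) {F} (h : Sm F) : Bd T m F (supNT T m F) := by
  intro j k hjk t ht
  have hc : Continuous (fun r => |dz^[k] (dt^[j] (sb F)) t r|) :=
    (((h.sb.dt_iter j).dz_iter k).co.sl t).abs
  have hcl : IsClosed {r | |dz^[k] (dt^[j] (sb F)) t r| ≤ supNT T m F} :=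
    isClosed_le hc continuous_const
  have hsub : Ioo (0:ℝ) 2 ⊆ {r | |dz^[k] (dt^[j] (sb F)) t r| ≤ supNT T m F} := by
    intro r hr
    have h0 : 0 < r ^ 2 / 4 := by have := hr.1; positivity
    have h1 : r ^ 2 / 4 ≤ 1 := by have := hr.1; have := hr.2; nlinarith
    have := pt_le h hjk ht (z := r ^ 2 / 4) ⟨h0.le, h1⟩
    rw [Ddot_sb (h.dt_iter j) t k _ h0, ← dt_iter_sb,
      show r ^ 2 / 4 = (r / 2) ^ 2 by ring, Real.sqrt_sq (by linarith [hr.1])] at this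
    rwa [show 2 * (r / 2) = r by ring] at this
  have := closure_minimal hsub hcl
  rw [closure_Ioo (by norm_num)] at this
  exact fun r hr => this hr

theorem supNT_mono {T : ℝ} {m m' : ℕ} (hm : m ≤ m') {F} (h : Sm F) :
    supNT T m F ≤ supNT T m' F :=
  supNT_le h (fun j k hjk => supNT_Bd m' h j k (hjk.trans hm)) (supNT_nonneg _ _ _)

theorem landau {L d S0 S2 : ℝ} (hd : 0 < d) (hdL : d ≤ L / 2) (f f1 f2 : ℝ → ℝ)
    (h1 : ∀ x, HasDerivAt f (f1 x) x) (h2 : ∀ x, HasDerivAt f1 (f2 x) x)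
    (b0 : ∀ x ∈ Icc 0 L, |f x| ≤ S0) (b2 : ∀ x ∈ Icc 0 L, |f2 x| ≤ S2) :
    ∀ x ∈ Icc 0 L, |f1 x| ≤ 2 * S0 / d + d * S2 := by
  intro x hx
  obtain ⟨y, hy, hxy⟩ : ∃ y ∈ Icc 0 L, |y - x| = d := by
    rcases le_total x (L / 2) with hh | hh
    · exact ⟨x + d, ⟨by linarith [hx.1], by linarith⟩, by simp [abs_of_pos hd]⟩
    · exact ⟨x - d, ⟨by linarith, by linarith [hx.2]⟩, by simp [abs_of_pos hd]⟩
  have hS2 : 0 ≤ S2 := (abs_nonneg _).trans (b2 x hx)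
  have hsub : uIcc x y ⊆ Icc 0 L := by
    intro s hs
    rw [mem_uIcc] at hs
    rcases hs with hs | hs
    · exact ⟨hx.1.trans hs.1, hs.2.trans hy.2⟩
    · exact ⟨hy.1.trans hs.1, hs.2.trans hx.2⟩
  have e1 : ∀ s ∈ uIcc x y, |f1 s - f1 x| ≤ S2 * d := by
    intro s hs
    have := Convex.norm_image_sub_le_of_norm_hasDerivWithin_le (f := f1) (f' := f2) (C := S2)
      (s := Icc 0 L) (fun s _ => (h2 s).hasDerivWithinAt) b2 (convex_Icc 0 L) hx (hsub hs)
    refine this.trans ?_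
    have : |s - x| ≤ |y - x| := abs_sub_left_of_mem_uIcc hs
    rw [Real.norm_eq_abs]
    exact mul_le_mul_of_nonneg_left (this.trans_eq hxy) hS2
  have e2 := Convex.norm_image_sub_le_of_norm_hasDerivWithin_le
    (f := fun s => f s - f1 x * s) (f' := fun s => f1 s - f1 x) (C := S2 * d)
      (s := uIcc x y) (fun s _ => by
        have := (h1 s).sub ((hasDerivAt_id s).const_mul (f1 x))
        rw [mul_one] at this
        exact this.hasDerivWithinAt) e1 (convex_uIcc x y) left_mem_uIcc right_mem_uIcc
  rw [Real.norm_eq_abs, Real.norm_eq_abs, hxy] at e2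
  have e3 : |f1 x * (y - x)| ≤ 2 * S0 + S2 * d * d := by
    have a := abs_le.1 e2
    have b := abs_le.1 (b0 x hx)
    have c := abs_le.1 (b0 y hy)
    rw [abs_le]; constructor <;> linarith [a.1, a.2, b.1, b.2, c.1, c.2]
  rw [abs_mul, hxy] at e3
  have : |f1 x| ≤ (2 * S0 + S2 * d * d) / d := by rw [le_div_iff₀ hd]; exact e3
  refine this.trans_eq ?_
  field_simp

theorem sup_interp {T : ℝ} (hT : 0 < T) : ∃ K > 0, ∀ F, Sm F → ∀ m : ℕ, ∀ e : ℝ, 0 < e → e ≤ 1 →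
    supNT T (m + 1) F ≤ K * (supNT T m F / e + e * supNT T (m + 2) F) := by
  set d0 := min 1 (T / 2) with hd0
  have d0p : 0 < d0 := by positivity
  have d01 : d0 ≤ 1 := min_le_left _ _
  have d0T : d0 ≤ T / 2 := min_le_right _ _
  refine ⟨2 / d0, by positivity, fun F h m e he he1 => ?_⟩
  have hA := supNT_nonneg T m F
  have hB := supNT_nonneg T (m + 2) F
  have hK : 2 ≤ 2 / d0 := by rw [le_div_iff₀ d0p]; linarith
  have h1 : e * d0 ≤ d0 := by nlinarith
  have hbig : 2 * supNT T m F / (e * d0) + e * d0 * supNT T (m + 2) F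
      ≤ 2 / d0 * (supNT T m F / e + e * supNT T (m + 2) F) := by
    have : d0 * (e * supNT T (m + 2) F) ≤ 2 / d0 * (e * supNT T (m + 2) F) := by
      gcongr; linarith
    calc _ = 2 / d0 * (supNT T m F / e) + d0 * (e * supNT T (m + 2) F) := by
          field_simp
      _ ≤ _ := by rw [mul_add]; linarith
  apply supNT_le h _ (by positivity)
  intro j k hjk t ht r hr
  by_cases hlt : j + k ≤ m
  · calc _ ≤ supNT T m F := supNT_Bd m h j k hlt t ht r hr
      _ ≤ supNT T m F / e := by rw [le_div_iff₀ he]; nlinarith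
      _ ≤ supNT T m F / e + e * supNT T (m + 2) F := by
        have : 0 ≤ e * supNT T (m + 2) F := by positivity
        linarith
      _ ≤ _ := le_mul_of_one_le_left (by positivity) (by linarith)
  · refine le_trans ?_ hbig
    rcases Nat.eq_zero_or_pos k with rfl | hk
    · obtain ⟨i, rfl⟩ : ∃ i, j = i + 1 := ⟨j - 1, by omega⟩
      refine landau (L := T) (by positivity) (h1.trans d0T) (fun s => dt^[i] (sb F) s r)
        (fun s => dt^[i + 1] (sb F) s r) (fun s => dt^[i + 2] (sb F) s r) ?_ ?_ ?_ ?_ t ht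
      · intro s; rw [Function.iterate_succ_apply']; exact (h.sb.dt_iter i).ht s r
      · intro s; rw [Function.iterate_succ_apply' (n := i + 1)]; exact (h.sb.dt_iter (i + 1)).ht s r
      · intro s hs; exact supNT_Bd m h i 0 (by omega) s hs r hr
      · intro s hs; exact supNT_Bd (m + 2) h (i + 2) 0 (by omega) s hs r hr
    · obtain ⟨i, rfl⟩ : ∃ i, k = i + 1 := ⟨k - 1, by omega⟩
      have hs := h.sb.dt_iter j
      refine landau (L := 2) (by positivity) (by linarith) (fun s => dz^[i] (dt^[j] (sb F)) t s)
        (fun s => dz^[i + 1] (dt^[j] (sb F)) t s) (fun s => dz^[i + 2] (dt^[j] (sb F)) t s)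
        ?_ ?_ ?_ ?_ r hr
      · intro s; rw [Function.iterate_succ_apply']; exact (hs.dz_iter i).hz t s
      · intro s; rw [Function.iterate_succ_apply' (n := i + 1)]; exact (hs.dz_iter (i + 1)).hz t s
      · intro s hs; exact supNT_Bd m h j i (by omega) t ht s hs
      · intro s hs; exact supNT_Bd (m + 2) h j (i + 2) (by omega) t ht s hs

theorem sup_mult {T : ℝ} (hT : 0 < T) : ∃ L ≥ 1, ∀ F, Sm F → ∀ m : ℕ,
    supNT T (m + 1) F ^ 2 ≤ L * (supNT T m F * supNT T (m + 2) F) := by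
  obtain ⟨K, hK, h⟩ := sup_interp hT
  refine ⟨4 * K ^ 2 + 1, by nlinarith, fun F hF m => ?_⟩
  have := mult_of_add (supNT_nonneg _ _ _) (supNT_nonneg _ _ _)
    (supNT_mono (T := T) (show m ≤ m + 2 by omega) hF) hK.le (h F hF m)
  have h1 := mul_nonneg (supNT_nonneg T m F) (supNT_nonneg T (m + 2) F)
  linarith

end S13

namespace S13

theorem hz_sb {F} (h : Sm F) (t r : ℝ) : HasDerivAt (sb F t) (r / 2 * sb (dz F) t r) r := by
  have h1 : HasDerivAt (fun r : ℝ => r ^ 2 / 4) (r / 2) r := by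
    have := ((hasDerivAt_id r).pow 2).div_const 4
    refine HasDerivAt.congr_deriv this ?_
    simp; ring
  have := (h.hz t (r ^ 2 / 4)).comp r h1
  refine HasDerivAt.congr_deriv this ?_
  simp only [sb]; ring

theorem dz_sb {F} (h : Sm F) : dz (sb F) = fun t r => r / 2 * sb (dz F) t r :=
  dz_of (hz_sb h)

theorem dzdz_sb {F} (h : Sm F) : dz (dz (sb F)) = sb (delT 1 F) := by
  rw [dz_sb h]
  apply dz_of
  intro t r
  have h1 : HasDerivAt (fun r : ℝ => r / 2) (1 / 2) r := (hasDerivAt_id r).div_const 2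
  refine HasDerivAt.congr_deriv (h1.mul (hz_sb h.dz t r)) ?_
  simp only [sb, delT_eq]; ring

theorem sb_delT_iter {F} (h : Sm F) (s : ℕ) : sb ((delT 1)^[s] F) = dz^[2 * s] (sb F) := by
  induction s with
  | zero => rfl
  | succ s ih =>
    rw [show 2 * (s + 1) = 2 * s + 1 + 1 by ring, Function.iterate_succ_apply',
      Function.iterate_succ_apply', Function.iterate_succ_apply', ← ih,
      dzdz_sb (h.delT_iter 1 s)]

theorem delT1_le {T : ℝ} {F} (h : Sm F) (i s : ℕ) {t z : ℝ} (ht : t ∈ Icc (0:ℝ) T)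
    (hz : z ∈ Icc (0:ℝ) 1) : |(delT 1)^[s] (dt^[i] F) t z| ≤ supNT T (i + 2 * s) F := by
  have hr : Real.sqrt z ≤ 1 := Real.sqrt_le_one.2 hz.2
  have h0 : 0 ≤ Real.sqrt z := Real.sqrt_nonneg z
  have := supNT_Bd (T := T) (i + 2 * s) h i (2 * s) le_rfl t ht (2 * Real.sqrt z)
    ⟨by linarith, by linarith⟩
  rw [dt_iter_sb, ← sb_delT_iter (h.dt_iter i)] at this
  unfold sb at this
  rwa [mul_pow, Real.sq_sqrt hz.1, show (2:ℝ) ^ 2 * z / 4 = z by ring] at this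

theorem maxp1 {a K : ℝ} (ha : 0 < a) (v v' : ℝ → ℝ) (h : ∀ z, HasDerivAt v (v' z) z)
    (hg : ∀ z ∈ Icc (0:ℝ) 1, z * v' z + a * v z ≤ K) :
    ∀ z ∈ Icc (0:ℝ) 1, v z ≤ K / a := by
  intro z hz
  rcases hz.1.eq_or_lt with h0 | h0
  · have := hg z hz
    rw [le_div_iff₀ ha]
    rw [← h0] at this ⊢
    linarith
  have hvc : Continuous v := continuous_iff_continuousAt.2 fun z => (h z).continuousAt
  have hm : MonotoneOn (fun z : ℝ => z ^ a * (K / a - v z)) (Icc 0 1) := by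
    apply monotoneOn_of_hasDerivWithinAt_nonneg (convex_Icc 0 1)
      (f' := fun z : ℝ => a * z ^ (a - 1) * (K / a - v z) + z ^ a * (0 - v' z))
    · have : Continuous (fun z : ℝ => z ^ a) := Real.continuous_rpow_const ha.le
      fun_prop
    · intro x hx
      rw [interior_Icc] at hx
      have h1 := Real.hasDerivAt_rpow_const (p := a) (Or.inl hx.1.ne')
      exact (h1.mul ((hasDerivAt_const x (K / a)).sub (h x))).hasDerivWithinAt
    · intro x hx
      rw [interior_Icc] at hx
      have h2 : x ^ a = x ^ (a - 1) * x := by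
        rw [← Real.rpow_add_one hx.1.ne']; congr 1; ring
      have h3 := hg x ⟨hx.1.le, hx.2.le⟩
      have h4 : 0 ≤ x ^ (a - 1) := Real.rpow_nonneg hx.1.le _
      have : a * x ^ (a - 1) * (K / a - v x) + x ^ a * (0 - v' x)
          = x ^ (a - 1) * (K - (x * v' x + a * v x)) := by
        rw [h2]; field_simp; ring
      rw [this]
      exact mul_nonneg h4 (by linarith)
  have := hm ⟨le_rfl, zero_le_one⟩ hz hz.1
  simp only [Real.zero_rpow ha.ne', zero_mul] at this
  have hp : 0 < z ^ a := Real.rpow_pos_of_pos h0 a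
  have := nonneg_of_mul_nonneg_right this hp
  linarith

theorem maxp {a K : ℝ} (ha : 0 < a) (v v' : ℝ → ℝ) (h : ∀ z, HasDerivAt v (v' z) z)
    (hg : ∀ z ∈ Icc (0:ℝ) 1, |z * v' z + a * v z| ≤ K) :
    ∀ z ∈ Icc (0:ℝ) 1, |v z| ≤ K / a := by
  intro z hz
  have h1 := maxp1 ha v v' h (fun z hz => (le_abs_self _).trans (hg z hz)) z hz
  have h2 := maxp1 (K := K) ha (fun z => - v z) (fun z => - v' z) (fun z => (h z).neg)
    (fun z hz => by have := (abs_le.1 (hg z hz)).1; linarith) z hz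
  rw [abs_le]; constructor <;> linarith

theorem dz_iter_delT {F} (h : Sm F) (k : ℕ) : dz^[k] (delT 1 F)
    = fun t z => z * dz^[k + 2] F t z + (k + 1 / 2) * dz^[k + 1] F t z := by
  induction k with
  | zero => rw [delT_eq]; funext t z; simp
  | succ k ih =>
    rw [Function.iterate_succ_apply', ih]
    apply dz_of
    intro t z
    have e2 := (h.dz_iter (k + 2)).hz t z
    have e1 := (h.dz_iter (k + 1)).hz t z
    rw [← Function.iterate_succ_apply' (f := dz)] at e1 e2
    refine HasDerivAt.congr_deriv (((hasDerivAt_id z).mul e2).add (e1.const_mul _)) ?_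
    simp only [id]
    push_cast
    rw [show k + 1 + 2 = k + 2 + 1 by ring, show (k + 1).succ = k + 1 + 1 by rfl,
      show (k + 2).succ = k + 2 + 1 by rfl, show k + 1 + 1 = k + 2 by rfl]
    ring

theorem coef (s : ℕ) : ∃ C ≥ (0:ℝ), ∀ F, Sm F → ∀ t K : ℝ,
    (∀ z ∈ Icc (0:ℝ) 1, |(delT 1)^[s] F t z| ≤ K) → ∀ e ≤ s, ∀ z ∈ Icc (0:ℝ) 1,
      |z ^ e * dz^[s + e] F t z| ≤ C * K := by
  induction s with
  | zero =>
    refine ⟨1, zero_le_one, fun F h t K hK e he z hz => ?_⟩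
    obtain rfl : e = 0 := by omega
    simpa using hK z hz
  | succ s ih =>
    obtain ⟨C, hC, ih⟩ := ih
    refine ⟨(2 * s + 2) ^ (s + 1) * (2 * C), by positivity, fun F h t K hK => ?_⟩
    have hK0 : 0 ≤ K := (abs_nonneg _).trans (hK 0 ⟨le_rfl, zero_le_one⟩)
    have hG := ih (delT 1 F) (h.delT 1) t K (by
      intro z hz; rw [← Function.iterate_succ_apply]; exact hK z hz)
    have hCK : 0 ≤ C * K := by positivity
    have key : ∀ e ≤ s + 1, ∀ z ∈ Icc (0:ℝ) 1,
        |z ^ e * dz^[s + 1 + e] F t z| ≤ (2 * s + 2) ^ e * (2 * (C * K)) := by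
      intro e
      induction e with
      | zero =>
        intro _ z hz
        have := maxp (a := s + 1 / 2) (K := C * K) (by positivity)
          (dz^[s + 1] F t) (dz^[s + 2] F t)
          (fun z => by
            rw [Function.iterate_succ_apply' (n := s + 1)]; exact (h.dz_iter (s + 1)).hz t z)
          (fun z hz => by
            have := hG 0 (Nat.zero_le _) z hz
            rw [pow_zero, one_mul, add_zero, dz_iter_delT h] at this
            exact this) z hz
        rw [pow_zero, one_mul, pow_zero, one_mul]
        refine this.trans ?_
        rw [div_le_iff₀ (by positivity)]
        have : 0 ≤ (s:ℝ) := by positivity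
        nlinarith
      | succ e ihe =>
        intro he z hz
        have h1 := ihe (by omega) z hz
        have h2 := hG e (by omega) z hz
        rw [dz_iter_delT h] at h2
        have e1 : s + 1 + (e + 1) = s + e + 2 := by ring
        have e2 : s + 1 + e = s + e + 1 := by ring
        rw [e1]
        rw [e2] at h1
        have h3 : z ^ (e + 1) * dz^[s + e + 2] F t z
            = z ^ e * (z * dz^[s + e + 2] F t z + ((s + e : ℕ) + 1 / 2) * dz^[s + e + 1] F t z)
              - (s + e + 1 / 2) * (z ^ e * dz^[s + e + 1] F t z) := by
          push_cast; ring
        rw [h3]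
        have hes : (e:ℝ) ≤ s := by exact_mod_cast (by omega : e ≤ s)
        have hB : C * K ≤ (2 * s + 2 : ℝ) ^ e * (2 * (C * K)) := by
          have : 1 ≤ (2 * s + 2 : ℝ) ^ e := one_le_pow₀ (by
            have : (0:ℝ) ≤ s := by positivity
            linarith)
          nlinarith
        have hcoef : |(s + e + 1 / 2 : ℝ)| ≤ 2 * s + 1 := by
          rw [abs_of_nonneg (by positivity)]; linarith
        calc _ ≤ _ := abs_sub _ _
          _ ≤ C * K + (2 * s + 1) * ((2 * s + 2) ^ e * (2 * (C * K))) := by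
            rw [abs_mul (s + e + 1 / 2 : ℝ)]
            gcongr
          _ ≤ _ := by rw [pow_succ]; linarith
    intro e he z hz
    refine (key e he z hz).trans ?_
    have : (2 * s + 2 : ℝ) ^ e ≤ (2 * s + 2) ^ (s + 1) := pow_le_pow_right₀ (by
      have : (0:ℝ) ≤ s := by positivity
      linarith) he
    calc _ ≤ (2 * s + 2 : ℝ) ^ (s + 1) * (2 * (C * K)) := by gcongr
      _ = _ := by ring

theorem bbound (s e a : ℕ) (h1 : a ≤ 2 * s) (h2 : a ≤ s + e) : ∃ C ≥ (0:ℝ), ∀ F, Sm F →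
    ∀ (i : ℕ) (T : ℝ), ∀ t ∈ Icc (0:ℝ) T, ∀ z ∈ Icc (0:ℝ) 1,
      |z ^ e * dz^[a] (dt^[i] F) t z| ≤ C * supNT T (i + 2 * s) F := by
  rcases le_total s a with hs | hs
  · obtain ⟨C, hC, h⟩ := coef s
    refine ⟨C, hC, fun F hF i T t ht z hz => ?_⟩
    have := h (dt^[i] F) (hF.dt_iter i) t _ (fun z hz => delT1_le hF i s ht hz) (a - s)
      (by omega) z hz
    rw [show s + (a - s) = a by omega] at this
    refine le_trans ?_ this
    rw [abs_mul, abs_mul]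
    have hz0 := hz.1
    rw [abs_of_nonneg (pow_nonneg hz0 _), abs_of_nonneg (pow_nonneg hz0 _)]
    exact mul_le_mul_of_nonneg_right (pow_le_pow_of_le_one hz0 hz.2 (by omega)) (abs_nonneg _)
  · obtain ⟨C, hC, h⟩ := coef a
    refine ⟨C, hC, fun F hF i T t ht z hz => ?_⟩
    have := h (dt^[i] F) (hF.dt_iter i) t _ (fun z hz => delT1_le hF i a ht hz) 0
      (by omega) z hz
    rw [pow_zero, one_mul, add_zero] at this
    rw [abs_mul, abs_of_nonneg (pow_nonneg hz.1 _)]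
    calc _ ≤ 1 * |dz^[a] (dt^[i] F) t z| := by
          gcongr; exact pow_le_one₀ hz.1 hz.2
      _ ≤ C * supNT T (i + 2 * a) F := by rw [one_mul]; exact this
      _ ≤ _ := by gcongr; exact supNT_mono (by omega) hF

end S13

namespace S13

theorem hsq_mult {N T : ℝ} (hN : 4 ≤ N) (hT : 0 < T) (n : ℕ) : ∃ L ≥ (1:ℝ), ∀ F, Sm F → ∀ τ : ℝ,
    0 < τ → (∀ t ∈ Icc (0:ℝ) τ, ∀ z, F t z = 0) → ∀ p ≤ n,
    hsq N T (p + 1) F ^ 2 ≤ L * (hsq N T p F * hsq N T (p + 2) F) := by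
  set K : ℝ := ((n + 2 : ℕ) : ℝ) ^ 3 * (3 + 4 * N ^ 2) with hK
  have hK0 : 0 ≤ K := by positivity
  refine ⟨4 * K ^ 2 + 1, by nlinarith, fun F h τ hτ h0 p hp => ?_⟩
  have hA := hsq_nonneg N T p F
  have hB := hsq_nonneg N T (p + 2) F
  have := mult_of_add (hsq_nonneg N T (p + 1) F) hA
    (hsq_mono hN hT (show p ≤ p + 2 by omega) h) hK0 (fun e he he1 => by
      refine (hsq_interp hN hT h hτ h0 p e he he1).trans ?_
      have : ((p + 2 : ℕ) : ℝ) ≤ ((n + 2 : ℕ) : ℝ) := by exact_mod_cast (by omega)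
      rw [hK]
      gcongr)
  have h1 := mul_nonneg hA hB
  linarith

theorem core {N T : ℝ} (hN : 4 ≤ N) (hT : 0 < T) (n : ℕ) (hn : 1 ≤ n) (M : ℝ) : ∃ C ≥ (0:ℝ),
    ∀ β H, Sm β → Sm H → ∀ τ : ℝ, 0 < τ → (∀ t ∈ Icc (0:ℝ) τ, ∀ z, H t z = 0) →
    supNT T 6 β ≤ M → ∀ m p : ℕ, m + p ≤ n + 6 → p ≤ n + 1 → m ≤ n + 4 →
    supNT T m β ^ 2 * hsq N T p H
      ≤ C * (hsq N T (n + 1) H + supNT T (n + 4) β ^ 2 * hsq N T 2 H) := by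
  obtain ⟨L1, hL1, h1⟩ := sup_mult hT
  obtain ⟨L2, hL2, h2⟩ := hsq_mult hN hT n
  have hL : 1 ≤ L1 ^ 2 * L2 := by nlinarith [one_le_pow₀ hL1 (n := 2)]
  set A := (L1 ^ 2 * L2) ^ ((n - 1) * (n - 1)) with hA
  have hA1 : 1 ≤ A := one_le_pow₀ hL
  refine ⟨A * (M ^ 2 + 1), by positivity, fun β H hβ hH τ hτ h0 hM m p hmp hp hm => ?_⟩
  set R := hsq N T (n + 1) H + supNT T (n + 4) β ^ 2 * hsq N T 2 H with hR
  have q0 : ∀ k, 0 ≤ hsq N T k H := fun k => hsq_nonneg N T k H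
  have b0 : ∀ k, 0 ≤ supNT T k β := fun k => supNT_nonneg T k β
  have hR1 : hsq N T (n + 1) H ≤ R := by
    have := mul_nonneg (pow_nonneg (b0 (n + 4)) 2) (q0 2); linarith
  have hR2 : supNT T (n + 4) β ^ 2 * hsq N T 2 H ≤ R := by linarith [q0 (n + 1)]
  have hR0 : 0 ≤ R := (q0 _).trans hR1
  have hb5 : ∀ k ≤ 6, supNT T k β ≤ M := fun k hk => (supNT_mono hk hβ).trans hM
  have hM0 : 0 ≤ M := (b0 6).trans hM
  have hMR : M ^ 2 * R ≤ A * (M ^ 2 + 1) * R := by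
    apply mul_le_mul_of_nonneg_right _ hR0
    nlinarith [sq_nonneg M]
  rcases le_total m 5 with h5 | h5
  · calc _ ≤ M ^ 2 * hsq N T (n + 1) H := by
          have := hb5 m (by omega)
          have := b0 m
          have := hsq_mono hN hT hp hH
          have := q0 p
          gcongr
      _ ≤ M ^ 2 * R := by gcongr
      _ ≤ _ := hMR
  · set c : ℕ → ℝ := fun s => supNT T (5 + s) β ^ 2 * hsq N T (n + 1 - s) H with hc
    have hd := disc_max c (n - 1) (L1 ^ 2 * L2) hL
      (fun s => mul_nonneg (pow_nonneg (b0 _) 2) (q0 _)) (by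
        intro s hs
        simp only [hc]
        have e1 := h1 β hβ (5 + s)
        have e2 := h2 H hH τ hτ h0 (n - 1 - s) (by omega)
        rw [show n - 1 - s + 1 = n + 1 - (s + 1) by omega,
          show n - 1 - s + 2 = n + 1 - s by omega,
          show n - 1 - s = n + 1 - (s + 2) by omega] at e2
        rw [show 5 + s + 1 = 5 + (s + 1) by ring, show 5 + s + 2 = 5 + (s + 2) by ring] at e1
        calc (supNT T (5 + (s + 1)) β ^ 2 * hsq N T (n + 1 - (s + 1)) H) ^ 2
            = (supNT T (5 + (s + 1)) β ^ 2) ^ 2 * hsq N T (n + 1 - (s + 1)) H ^ 2 := by ring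
          _ ≤ (L1 * (supNT T (5 + s) β * supNT T (5 + (s + 2)) β)) ^ 2 *
              (L2 * (hsq N T (n + 1 - (s + 2)) H * hsq N T (n + 1 - s) H)) := by gcongr
          _ = _ := by ring) (m - 5) (by omega)
    have hc1 : supNT T m β ^ 2 * hsq N T p H ≤ c (m - 5) := by
      simp only [hc]
      rw [show 5 + (m - 5) = m by omega]
      exact mul_le_mul_of_nonneg_left (hsq_mono hN hT (by omega) hH) (pow_nonneg (b0 _) 2)
    have hmax : max (c 0) (c (n - 1)) ≤ (M ^ 2 + 1) * R := by
      apply max_le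
      · simp only [hc]
        calc _ ≤ M ^ 2 * hsq N T (n + 1) H := by
              have := hb5 5 (by omega)
              have := b0 5
              have := q0 (n + 1)
              simp only [add_zero, Nat.sub_zero]
              gcongr
          _ ≤ M ^ 2 * R := by gcongr
          _ ≤ _ := by linarith
      · simp only [hc]
        rw [show 5 + (n - 1) = n + 4 by omega, show n + 1 - (n - 1) = 2 by omega]
        nlinarith [mul_nonneg (sq_nonneg M) hR0]
    calc _ ≤ _ := hc1
      _ ≤ _ := hd
      _ ≤ A * ((M ^ 2 + 1) * R) := by gcongr
      _ = _ := by ring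

end S13

namespace S13

/-- The data: coefficients and solution. -/
structure Dat (T M : ℝ) where
  b : Fin 3 → ℝ → ℝ → ℝ
  H : ℝ → ℝ → ℝ
  τ : ℝ
  hb : ∀ ι, Sm (b ι)
  hH : Sm H
  hτ : 0 < τ
  h0 : ∀ t ∈ Icc (0:ℝ) τ, ∀ z, H t z = 0
  hM : ∀ ι, supNT T 6 (b ι) ≤ M

/-- Derivatives of the coefficients. -/
noncomputable def bb {T M : ℝ} (d : Dat T M) (ι : Fin 3) (i a : ℕ) : ℝ → ℝ → ℝ :=
  dz^[a] (dt^[i] (d.b ι))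

/-- Derivatives of the solution. -/
noncomputable def hh (N : ℝ) {T M : ℝ} (d : Dat T M) (l q : ℕ) : ℝ → ℝ → ℝ :=
  (delT N)^[q] (dt^[l] d.H)

theorem bb_sm {T M : ℝ} (d : Dat T M) (ι : Fin 3) (i a : ℕ) : Sm (bb d ι i a) :=
  ((d.hb ι).dt_iter i).dz_iter a

theorem hh_sm (N : ℝ) {T M : ℝ} (d : Dat T M) (l q : ℕ) : Sm (hh N d l q) :=
  (d.hH.dt_iter l).delT_iter N q

theorem dz_bb {T M : ℝ} (d : Dat T M) (ι : Fin 3) (i a : ℕ) :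
    dz (bb d ι i a) = bb d ι i (a + 1) := by
  unfold bb; rw [Function.iterate_succ_apply']

theorem dt_bb {T M : ℝ} (d : Dat T M) (ι : Fin 3) (i a : ℕ) :
    dt (bb d ι i a) = bb d ι (i + 1) a := by
  unfold bb; rw [dt_dz_iter ((d.hb ι).dt_iter i), Function.iterate_succ_apply']

theorem delT_hh (N : ℝ) {T M : ℝ} (d : Dat T M) (l q : ℕ) :
    delT N (hh N d l q) = hh N d l (q + 1) := by
  unfold hh; rw [Function.iterate_succ_apply']

theorem dt_hh (N : ℝ) {T M : ℝ} (d : Dat T M) (l q : ℕ) :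
    dt (hh N d l q) = hh N d (l + 1) q := by
  unfold hh; rw [dt_delT_iter N (d.hH.dt_iter l), Function.iterate_succ_apply']

/-- The class of admissible terms. -/
inductive Cl (N T M : ℝ) : ℕ → ℕ → (Dat T M → ℝ → ℝ → ℝ) → Prop
  | zero (j μ : ℕ) : Cl N T M j μ (fun _ _ _ => 0)
  | add {j μ : ℕ} {Φ Ψ} (h1 : Cl N T M j μ Φ) (h2 : Cl N T M j μ Ψ) :
      Cl N T M j μ (fun d t z => Φ d t z + Ψ d t z)
  | smul {j μ : ℕ} {Φ} (c : ℝ) (h1 : Cl N T M j μ Φ) : Cl N T M j μ (fun d t z => c * Φ d t z)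
  | P {j μ : ℕ} (ι : Fin 3) (e i a l q : ℕ) (c1 : 1 ≤ i) (c2 : i + l ≤ j) (c3 : a + 2 * q ≤ 2 * μ)
      (c4 : a + q ≤ μ + e) :
      Cl N T M j μ (fun d t z => z ^ e * bb d ι i a t z * hh N d l q t z)
  | Q {j μ : ℕ} (ι : Fin 3) (e i a l q : ℕ) (c1 : 1 ≤ i) (c2 : i + l ≤ j)
      (c3 : a + 2 * q + 1 ≤ 2 * μ) (c4 : a + q ≤ μ + e) :
      Cl N T M j μ (fun d t z => z ^ e * bb d ι i a t z * (z * dz (hh N d l q) t z))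

theorem Cl.congr {N T M : ℝ} {j μ : ℕ} {Φ Ψ} (h : Cl N T M j μ Φ)
    (e : ∀ d t z, Ψ d t z = Φ d t z) : Cl N T M j μ Ψ := by
  have : Ψ = Φ := by funext d t z; exact e d t z
  rw [this]; exact h

theorem Cl.sm {N T M : ℝ} {j μ : ℕ} {Φ} (h : Cl N T M j μ Φ) : ∀ d, Sm (Φ d) := by
  intro d
  induction h with
  | zero => exact Sm.const 0
  | add _ _ h1 h2 => exact h1.add h2
  | smul c _ h1 => exact h1.smul c
  | P ι e i a l q => exact ((Sm.zpow e).mul (bb_sm d ι i a)).mul (hh_sm N d l q)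
  | Q ι e i a l q => exact ((Sm.zpow e).mul (bb_sm d ι i a)).mul (Sm.z.mul (hh_sm N d l q).dz)

theorem Cl.mono {N T M : ℝ} {j μ : ℕ} {Φ} (h : Cl N T M j μ Φ) {j' : ℕ} (hj : j ≤ j') :
    Cl N T M j' μ Φ := by
  induction h with
  | zero => exact Cl.zero _ _
  | add _ _ h1 h2 => exact h1.add h2
  | smul c _ h1 => exact h1.smul c
  | P ι e i a l q c1 c2 c3 c4 => exact Cl.P ι e i a l q c1 (c2.trans hj) c3 c4
  | Q ι e i a l q c1 c2 c3 c4 => exact Cl.Q ι e i a l q c1 (c2.trans hj) c3 c4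

theorem dt_kap {c : ℝ → ℝ → ℝ} (hc : Sm c) (e : ℕ) :
    dt (fun t z => z ^ e * c t z) = fun t z => z ^ e * dt c t z := by
  rw [dt_mul (Sm.zpow e) hc, dt_zpow]; funext t z; ring

theorem Cl.dt {N T M : ℝ} {j μ : ℕ} {Φ} (h : Cl N T M j μ Φ) :
    Cl N T M (j + 1) μ (fun d => _root_.dt (Φ d)) := by
  induction h with
  | zero => exact (Cl.zero _ _).congr fun d t z => by simp [_root_.dt]
  | add g1 g2 h1 h2 =>
    refine (h1.add h2).congr fun d t z => ?_
    rw [dt_add (g1.sm d) (g2.sm d)]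
  | smul c g1 h1 =>
    refine (h1.smul c).congr fun d t z => ?_
    rw [dt_smul c (g1.sm d)]
  | P ι e i a l q c1 c2 c3 c4 =>
    refine ((Cl.P ι e (i + 1) a l q (by omega) (by omega) c3 c4).add
      (Cl.P ι e i a (l + 1) q (by omega) (by omega) c3 c4)).congr fun d t z => ?_
    rw [dt_mul ((Sm.zpow e).mul (bb_sm d ι i a)) (hh_sm N d l q), dt_kap (bb_sm d ι i a), dt_bb, dt_hh]
  | Q ι e i a l q c1 c2 c3 c4 =>
    refine ((Cl.Q ι e (i + 1) a l q (by omega) (by omega) c3 c4).add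
      (Cl.Q ι e i a (l + 1) q (by omega) (by omega) c3 c4)).congr fun d t z => ?_
    rw [dt_mul ((Sm.zpow e).mul (bb_sm d ι i a)) (Sm.z.mul (hh_sm N d l q).dz),
      dt_kap (bb_sm d ι i a), dt_bb, dt_mul Sm.z (hh_sm N d l q).dz, dt_z,
      dt_dz (hh_sm N d l q), dt_hh]
    ring

theorem dz_kap {c : ℝ → ℝ → ℝ} (hc : Sm c) (e : ℕ) :
    dz (fun t z => z ^ e * c t z) = fun t z => e * z ^ (e - 1) * c t z + z ^ e * dz c t z := by
  rw [dz_mul (Sm.zpow e) hc, dz_zpow]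

theorem delT_kap {c : ℝ → ℝ → ℝ} (N : ℝ) (hc : Sm c) (e : ℕ) :
    delT N (fun t z => z ^ e * c t z) = fun t z => e * (e - 1 + N / 2) * (z ^ (e - 1) * c t z)
      + (2 * e + N / 2) * (z ^ e * dz c t z) + z ^ (e + 1) * dz (dz c) t z := by
  rw [delT_mul N (Sm.zpow e) hc, delT_eq, delT_eq, dz_zpow, dz_smul _ (Sm.zpow (e - 1)), dz_zpow]
  funext t z
  rcases e with _ | _ | e
  · simp; ring
  · simp; ring
  · simp only [Nat.add_sub_cancel]
    push_cast
    ring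

theorem delT_zdz {w : ℝ → ℝ → ℝ} (N : ℝ) (hw : Sm w) :
    delT N (fun t z => z * dz w t z) = fun t z => z * dz (delT N w) t z + delT N w t z := by
  have h1 : delT N (fun _ z => z) = fun _ _ => N / 2 := by
    rw [delT_eq, dz_z]
    have : dz (fun _ _ => (1:ℝ)) = fun _ _ => 0 := dz_of fun t z => hasDerivAt_const z 1
    rw [this]; funext t z; ring
  rw [delT_mul N Sm.z hw.dz, h1, dz_z]
  have h2 : dz (delT N w) = fun t z => 1 * dz (dz w) t z + z * dz (dz (dz w)) t z
      + N / 2 * dz (dz w) t z := by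
    rw [delT_eq, dz_add (Sm.z.mul hw.dz.dz) (hw.dz.smul _), dz_mul Sm.z hw.dz.dz, dz_z,
      dz_smul _ hw.dz]
  rw [h2, delT_eq, delT_eq]
  funext t z; ring

theorem dz_zdz {w : ℝ → ℝ → ℝ} (N : ℝ) (hw : Sm w) :
    dz (fun t z => z * dz w t z) = fun t z => delT N w t z + (1 - N / 2) * dz w t z := by
  rw [dz_mul Sm.z hw.dz, dz_z, delT_eq]; funext t z; ring

theorem mul_pow_pred (e : ℕ) (z : ℝ) : z * (e * z ^ (e - 1)) = e * z ^ e := by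
  rcases e with _ | e
  · simp
  · simp only [Nat.add_sub_cancel]; ring

theorem Cl.delT {N T M : ℝ} {j μ : ℕ} {Φ} (h : Cl N T M j μ Φ) :
    Cl N T M j (μ + 1) (fun d => S13.delT N (Φ d)) := by
  induction h with
  | zero => exact (Cl.zero _ _).congr fun d t z => by simp [S13.delT, Del]
  | add g1 g2 h1 h2 =>
    refine (h1.add h2).congr fun d t z => ?_
    rw [delT_add N (g1.sm d) (g2.sm d)]
  | smul c g1 h1 =>
    refine (h1.smul c).congr fun d t z => ?_
    rw [delT_smul N c (g1.sm d)]
  | P ι e i a l q c1 c2 c3 c4 =>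
    refine ((((Cl.P ι e i a l (q + 1) c1 c2 (by omega) (by omega)).add
      ((Cl.Q ι (e - 1) i a l q c1 c2 (by omega) (by omega)).smul (2 * e))).add
      ((Cl.Q ι e i (a + 1) l q c1 c2 (by omega) (by omega)).smul 2)).add
      ((((Cl.P ι (e - 1) i a l q c1 c2 (by omega) (by omega)).smul (e * (e - 1 + N / 2))).add
      ((Cl.P ι e i (a + 1) l q c1 c2 (by omega) (by omega)).smul (2 * e + N / 2))).add
      (Cl.P ι (e + 1) i (a + 2) l q c1 c2 (by omega) (by omega)))).congr fun d t z => ?_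
    rw [delT_mul N ((Sm.zpow e).mul (bb_sm d ι i a)) (hh_sm N d l q), dz_kap (bb_sm d ι i a),
      delT_kap N (bb_sm d ι i a), delT_hh, dz_bb, dz_bb]
    ring
  | Q ι e i a l q c1 c2 c3 c4 =>
    refine (((((Cl.Q ι e i a l (q + 1) c1 c2 (by omega) (by omega)).add
      (Cl.P ι e i a l (q + 1) c1 c2 (by omega) (by omega))).add
      (((Cl.P ι e i a l (q + 1) c1 c2 (by omega) (by omega)).smul (2 * e)).add
      ((Cl.P ι (e + 1) i (a + 1) l (q + 1) c1 c2 (by omega) (by omega)).smul 2))).add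
      (((Cl.Q ι (e - 1) i a l q c1 c2 (by omega) (by omega)).smul (2 * (1 - N / 2) * e)).add
      ((Cl.Q ι e i (a + 1) l q c1 c2 (by omega) (by omega)).smul (2 * (1 - N / 2))))).add
      ((((Cl.Q ι (e - 1) i a l q c1 c2 (by omega) (by omega)).smul (e * (e - 1 + N / 2))).add
      ((Cl.Q ι e i (a + 1) l q c1 c2 (by omega) (by omega)).smul (2 * e + N / 2))).add
      (Cl.Q ι (e + 1) i (a + 2) l q c1 c2 (by omega) (by omega)))).congr fun d t z => ?_
    have hw := hh_sm N d l q
    rw [delT_mul N ((Sm.zpow e).mul (bb_sm d ι i a)) (Sm.z.mul hw.dz), dz_kap (bb_sm d ι i a),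
      delT_kap N (bb_sm d ι i a), delT_zdz N hw, dz_zdz N hw, delT_hh, dz_bb, dz_bb]
    have hm := mul_pow_pred e z
    linear_combination (2 * bb d ι i a t z * hh N d l (q + 1) t z) * hm

/-- The commutator. -/
noncomputable def KK (N : ℝ) {T M : ℝ} (j : ℕ) (d : Dat T M) : ℝ → ℝ → ℝ :=
  fun t z => dt^[j] (opA N (d.b 0) (d.b 1) (d.b 2) d.H) t z
    - opA N (d.b 0) (d.b 1) (d.b 2) (dt^[j] d.H) t z

theorem opA_eq (N : ℝ) (b₂ b₁ b₀ H : ℝ → ℝ → ℝ) : opA N b₂ b₁ b₀ H =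
    fun t z => (-1) * (b₂ t z * delT N H t z) + b₁ t z * (z * dz H t z) + b₀ t z * H t z := by
  funext t z; simp only [opA, delT, dz]; ring

theorem opA_sm (N : ℝ) {b₂ b₁ b₀ H : ℝ → ℝ → ℝ} (h2 : Sm b₂) (h1 : Sm b₁) (h0 : Sm b₀)
    (h : Sm H) : Sm (opA N b₂ b₁ b₀ H) := by
  rw [opA_eq]
  exact (((h2.mul (h.delT N)).smul _).add (h1.mul (Sm.z.mul h.dz))).add (h0.mul h)

theorem dt_opA (N : ℝ) {b₂ b₁ b₀ H : ℝ → ℝ → ℝ} (h2 : Sm b₂) (h1 : Sm b₁) (h0 : Sm b₀)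
    (h : Sm H) (t z : ℝ) : dt (opA N b₂ b₁ b₀ H) t z
      = opA N b₂ b₁ b₀ (dt H) t z + opA N (dt b₂) (dt b₁) (dt b₀) H t z := by
  rw [opA_eq, opA_eq, opA_eq,
    dt_add (((h2.mul (h.delT N)).smul _).add (h1.mul (Sm.z.mul h.dz))) (h0.mul h),
    dt_add ((h2.mul (h.delT N)).smul _) (h1.mul (Sm.z.mul h.dz)),
    dt_smul _ (h2.mul (h.delT N)), dt_mul h2 (h.delT N), dt_mul h1 (Sm.z.mul h.dz),
    dt_mul Sm.z h.dz, dt_mul h0 h, dt_z, dt_dz h, dt_delT N h]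
  ring

theorem KK_cl (N T M : ℝ) (j : ℕ) : Cl N T M j 1 (KK N j) := by
  induction j with
  | zero => exact (Cl.zero _ _).congr fun d t z => by simp [KK]
  | succ j ih =>
    refine (ih.dt.add ((((Cl.P 0 0 1 0 j 1 (by omega) (by omega) (by omega) (by omega)).smul
      (-1)).add (Cl.Q 1 0 1 0 j 0 (by omega) (by omega) (by omega) (by omega))).add
      (Cl.P 2 0 1 0 j 0 (by omega) (by omega) (by omega) (by omega)))).congr fun d t z => ?_
    have hA := opA_sm N (d.hb 0) (d.hb 1) (d.hb 2) d.hH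
    have hB := opA_sm N (d.hb 0) (d.hb 1) (d.hb 2) (d.hH.dt_iter j)
    have e : dt (KK N j d) t z = dt^[j + 1] (opA N (d.b 0) (d.b 1) (d.b 2) d.H) t z
        - (opA N (d.b 0) (d.b 1) (d.b 2) (dt^[j + 1] d.H) t z
          + opA N (dt (d.b 0)) (dt (d.b 1)) (dt (d.b 2)) (dt^[j] d.H) t z) := by
      unfold KK
      rw [dt_sub (hA.dt_iter j) hB, Function.iterate_succ_apply', Function.iterate_succ_apply',
        ← dt_opA N (d.hb 0) (d.hb 1) (d.hb 2) (d.hH.dt_iter j)]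
    rw [e, opA_eq N (dt (d.b 0))]
    simp only [KK, bb, hh, Function.iterate_zero, id, Function.iterate_one, pow_zero]
    ring

theorem KK_delT (N T M : ℝ) (j m : ℕ) : Cl N T M j (m + 1) (fun d => (delT N)^[m] (KK N j d)) := by
  induction m with
  | zero => exact KK_cl N T M j
  | succ m ih => simp only [Function.iterate_succ_apply']; exact ih.delT

end S13

namespace S13

/-- The right-hand side quantity. -/
noncomputable def R2 (N : ℝ) {T M : ℝ} (n : ℕ) (d : Dat T M) : ℝ :=
  hsq N T (n + 1) d.H + (∑ ι, supNT T (n + 4) (d.b ι)) ^ 2 * hsq N T 2 d.H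

theorem R2_nonneg (N : ℝ) {T M : ℝ} (n : ℕ) (d : Dat T M) : 0 ≤ R2 N n d :=
  add_nonneg (hsq_nonneg _ _ _ _) (mul_nonneg (sq_nonneg _) (hsq_nonneg _ _ _ _))

/-- Good control. -/
def GC (N T M : ℝ) (n : ℕ) (Φ : Dat T M → ℝ → ℝ → ℝ) : Prop :=
  (∀ d, Co (Φ d)) ∧ ∃ C ≥ (0:ℝ), ∀ d, dbl N T (Φ d) ≤ C * R2 N n d

theorem GC.congr {N T M : ℝ} {n : ℕ} {Φ Ψ} (h : GC N T M n Φ)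
    (e : ∀ d t z, Ψ d t z = Φ d t z) : GC N T M n Ψ := by
  have : Ψ = Φ := by funext d t z; exact e d t z
  rw [this]; exact h

theorem GC.zero {N T M : ℝ} {n : ℕ} : GC N T M n (fun _ _ _ => 0) :=
  ⟨fun _ => Co.const 0, 0, le_rfl, fun d => by simp [dbl, sq]⟩

theorem GC.add {N T M : ℝ} (hN : 4 ≤ N) (hT : 0 < T) {n : ℕ} {Φ Ψ} (h1 : GC N T M n Φ)
    (h2 : GC N T M n Ψ) : GC N T M n (fun d t z => Φ d t z + Ψ d t z) := by
  obtain ⟨c1, C1, p1, h1⟩ := h1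
  obtain ⟨c2, C2, p2, h2⟩ := h2
  refine ⟨fun d => (c1 d).add (c2 d), 2 * C1 + 2 * C2, by positivity, fun d => ?_⟩
  have := dbl_add hN hT (c1 d) (c2 d)
  linarith [h1 d, h2 d]

theorem GC.smul {N T M : ℝ} {n : ℕ} {Φ} (c : ℝ) (h1 : GC N T M n Φ) :
    GC N T M n (fun d t z => c * Φ d t z) := by
  obtain ⟨c1, C1, p1, h1⟩ := h1
  refine ⟨fun d => (c1 d).smul c, c ^ 2 * C1, by positivity, fun d => ?_⟩
  rw [dbl_smul, mul_assoc]
  exact mul_le_mul_of_nonneg_left (h1 d) (sq_nonneg c)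

theorem GC.base {N T M : ℝ} (hN : 4 ≤ N) (hT : 0 < T) {n : ℕ} (hn : 1 ≤ n) (ι : Fin 3)
    (e i a l k s : ℕ) (g : Dat T M → ℝ → ℝ → ℝ) (hg : ∀ d, Co (g d))
    (hgb : ∀ d t, ∀ z ∈ Icc (0:ℝ) 1, |g d t z| ≤ |grad N k (dt^[l] d.H) t z|)
    (h1 : a ≤ 2 * s) (h2 : a ≤ s + e) (h3 : i + 2 * s + (l + k) ≤ n + 6) (h4 : l + k ≤ n + 1)
    (h5 : i + 2 * s ≤ n + 4) :
    GC N T M n (fun d t z => z ^ e * bb d ι i a t z * g d t z) := by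
  have hco : ∀ d, Co (fun t z => z ^ e * bb d ι i a t z * g d t z) := fun d =>
    ((Sm.zpow e).mul (bb_sm d ι i a)).co.mul (hg d)
  obtain ⟨C1, p1, hb⟩ := bbound s e a h1 h2
  obtain ⟨C2, p2, hc⟩ := core hN hT n hn M
  refine ⟨hco, C1 ^ 2 * C2, by positivity, fun d => ?_⟩
  have hgr : Co (grad N k (dt^[l] d.H)) := (d.hH.dt_iter l).grad_co N k
  set β := supNT T (i + 2 * s) (d.b ι) with hβ
  have hβ0 : 0 ≤ β := supNT_nonneg _ _ _
  have s1 : dbl N T (fun t z => z ^ e * bb d ι i a t z * g d t z)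
      ≤ dbl N T (fun t z => (C1 * β) * grad N k (dt^[l] d.H) t z) := by
    apply dbl_mono hN hT (hco d) (hgr.smul _)
    intro t ht z hz
    rw [abs_mul, abs_mul (C1 * β), abs_of_nonneg (mul_nonneg p1 hβ0)]
    exact mul_le_mul (hb (d.b ι) (d.hb ι) i T t ht z hz) (hgb d t z hz) (abs_nonneg _)
      (mul_nonneg p1 hβ0)
  rw [dbl_smul] at s1
  have s2 := dbl_le_hsq hN hT (le_refl (l + k)) d.hH
  have s3 := hc (d.b ι) d.H (d.hb ι) d.hH d.τ d.hτ d.h0 (d.hM ι) (i + 2 * s) (l + k) h3 h4 h5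
  have s4 : hsq N T (n + 1) d.H + supNT T (n + 4) (d.b ι) ^ 2 * hsq N T 2 d.H ≤ R2 N n d := by
    unfold R2
    have a1 : supNT T (n + 4) (d.b ι) ≤ ∑ ι, supNT T (n + 4) (d.b ι) :=
      Finset.single_le_sum (f := fun ι => supNT T (n + 4) (d.b ι))
        (fun _ _ => supNT_nonneg _ _ _) (Finset.mem_univ ι)
    have a2 := supNT_nonneg T (n + 4) (d.b ι)
    have a3 := hsq_nonneg N T 2 d.H
    gcongr
  calc _ ≤ _ := s1
    _ ≤ (C1 * β) ^ 2 * hsq N T (l + k) d.H := by gcongr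
    _ = C1 ^ 2 * (β ^ 2 * hsq N T (l + k) d.H) := by ring
    _ ≤ C1 ^ 2 * (C2 * R2 N n d) := by
      refine mul_le_mul_of_nonneg_left (s3.trans ?_) (sq_nonneg _)
      exact mul_le_mul_of_nonneg_left s4 p2
    _ = _ := by ring

theorem hh_grad {N T M : ℝ} (d : Dat T M) (l q : ℕ) :
    grad N (2 * q) (dt^[l] d.H) = hh N d l q := grad_even _ _ _

theorem hh_grad' {N T M : ℝ} (d : Dat T M) (l q : ℕ) :
    grad N (2 * q + 1) (dt^[l] d.H) = fun t z => Real.sqrt z * dz (hh N d l q) t z :=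
  grad_odd _ _ _

theorem z_le_sqrt {z : ℝ} (hz : z ∈ Icc (0:ℝ) 1) : z ≤ Real.sqrt z := by
  have h0 := Real.sqrt_nonneg z
  have h1 : Real.sqrt z ≤ 1 := Real.sqrt_le_one.2 hz.2
  have h2 := Real.mul_self_sqrt hz.1
  nlinarith

theorem abs_le_scale {s w x : ℝ} (h0 : 0 ≤ s) (h : s ≤ w) : |s * x| ≤ |w * x| := by
  rw [abs_mul, abs_mul, abs_of_nonneg h0, abs_of_nonneg (h0.trans h)]
  exact mul_le_mul_of_nonneg_right h (abs_nonneg _)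

theorem gc_even {N T M : ℝ} (hN : 4 ≤ N) (hT : 0 < T) {n : ℕ} (hn : 1 ≤ n) {j μ : ℕ} {Φ}
    (h : Cl N T M j μ Φ) (hj : j + 2 * μ ≤ n + 2) : GC N T M n Φ := by
  induction h with
  | zero => exact GC.zero
  | add _ _ h1 h2 => exact h1.add hN hT h2
  | smul c _ h1 => exact h1.smul c
  | P ι e i a l q c1 c2 c3 c4 =>
    exact GC.base hN hT hn ι e i a l (2 * q) (μ - q) _ (fun d => (hh_sm N d l q).co)
      (fun d t z hz => by rw [hh_grad]) (by omega) (by omega) (by omega) (by omega) (by omega)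
  | Q ι e i a l q c1 c2 c3 c4 =>
    refine GC.base hN hT hn ι e i a l (2 * q + 1) (μ - q) _
      (fun d => (Sm.z.mul (hh_sm N d l q).dz).co)
      (fun d t z hz => ?_) (by omega) (by omega) (by omega) (by omega) (by omega)
    rw [hh_grad']
    exact abs_le_scale hz.1 (z_le_sqrt hz)

theorem gc_odd {N T M : ℝ} (hN : 4 ≤ N) (hT : 0 < T) {n : ℕ} (hn : 1 ≤ n) {j μ : ℕ} {Φ}
    (h : Cl N T M j μ Φ) (hj : j + 2 * μ ≤ n + 1) :
    GC N T M n (fun d t z => Real.sqrt z * dz (Φ d) t z) := by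
  have sq1 : ∀ z ∈ Icc (0:ℝ) 1, Real.sqrt z ≤ 1 := fun z hz => Real.sqrt_le_one.2 hz.2
  induction h with
  | zero => exact GC.zero.congr fun d t z => by simp [dz]
  | add g1 g2 h1 h2 =>
    refine (h1.add hN hT h2).congr fun d t z => ?_
    rw [dz_add (g1.sm d) (g2.sm d)]; ring
  | smul c g1 h1 =>
    refine (h1.smul c).congr fun d t z => ?_
    rw [dz_smul c (g1.sm d)]; ring
  | P ι e i a l q c1 c2 c3 c4 =>
    have cg : ∀ d : Dat T M, Co (fun t z => Real.sqrt z * hh N d l q t z) :=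
      fun d => Co.sqrtz.mul (hh_sm N d l q).co
    have bg : ∀ (d : Dat T M) (t : ℝ), ∀ z ∈ Icc (0:ℝ) 1, |Real.sqrt z * hh N d l q t z|
        ≤ |grad N (2 * q) (dt^[l] d.H) t z| := fun d t z hz => by
      rw [hh_grad]
      exact (abs_le_scale (Real.sqrt_nonneg z) (sq1 z hz)).trans_eq (by rw [one_mul])
    have t1 := GC.base (n := n) (M := M) hN hT hn ι (e - 1) i a l (2 * q) (μ - q + 1) _ cg bg
      (by omega) (by omega) (by omega) (by omega) (by omega)
    have t2 := GC.base (n := n) (M := M) hN hT hn ι e i (a + 1) l (2 * q) (μ - q + 1) _ cg bg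
      (by omega) (by omega) (by omega) (by omega) (by omega)
    have t3 := GC.base (n := n) (M := M) hN hT hn ι e i a l (2 * q + 1) (μ - q)
      (fun d t z => Real.sqrt z * dz (hh N d l q) t z)
      (fun d => Co.sqrtz.mul (hh_sm N d l q).dz.co) (fun d t z hz => by rw [hh_grad'])
      (by omega) (by omega) (by omega) (by omega) (by omega)
    refine (((t1.smul e).add hN hT t2).add hN hT t3).congr fun d t z => ?_
    rw [dz_mul ((Sm.zpow e).mul (bb_sm d ι i a)) (hh_sm N d l q), dz_kap (bb_sm d ι i a), dz_bb]
    ring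
  | Q ι e i a l q c1 c2 c3 c4 =>
    have cg : ∀ d : Dat T M, Co (fun t z => Real.sqrt z * z * dz (hh N d l q) t z) :=
      fun d => (Co.sqrtz.mul Sm.z.co).mul (hh_sm N d l q).dz.co
    have bg : ∀ (d : Dat T M) (t : ℝ), ∀ z ∈ Icc (0:ℝ) 1,
        |Real.sqrt z * z * dz (hh N d l q) t z|
        ≤ |grad N (2 * q + 1) (dt^[l] d.H) t z| := fun d t z hz => by
      rw [hh_grad']
      have := Real.sqrt_nonneg z
      exact abs_le_scale (mul_nonneg this hz.1) (mul_le_of_le_one_right this hz.2)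
    have t1 := GC.base (n := n) (M := M) hN hT hn ι (e - 1) i a l (2 * q + 1) (μ - q + 1) _ cg bg
      (by omega) (by omega) (by omega) (by omega) (by omega)
    have t2 := GC.base (n := n) (M := M) hN hT hn ι e i (a + 1) l (2 * q + 1) (μ - q + 1) _ cg bg
      (by omega) (by omega) (by omega) (by omega) (by omega)
    have t3 := GC.base (n := n) (M := M) hN hT hn ι e i a l (2 * q + 1) (μ - q)
      (fun d t z => Real.sqrt z * dz (hh N d l q) t z)
      (fun d => Co.sqrtz.mul (hh_sm N d l q).dz.co) (fun d t z hz => by rw [hh_grad'])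
      (by omega) (by omega) (by omega) (by omega) (by omega)
    have t4 := GC.base (n := n) (M := M) hN hT hn ι e i a l (2 * (q + 1)) (μ - q)
      (fun d t z => Real.sqrt z * hh N d l (q + 1) t z)
      (fun d => Co.sqrtz.mul (hh_sm N d l (q + 1)).co) (fun d t z hz => by
        rw [hh_grad]
        exact (abs_le_scale (Real.sqrt_nonneg z) (sq1 z hz)).trans_eq (by rw [one_mul]))
      (by omega) (by omega) (by omega) (by omega) (by omega)
    refine ((((t1.smul e).add hN hT t2).add hN hT t4).add hN hT
      (t3.smul (1 - N / 2))).congr fun d t z => ?_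
    have hw := hh_sm N d l q
    rw [dz_mul ((Sm.zpow e).mul (bb_sm d ι i a)) (Sm.z.mul hw.dz), dz_kap (bb_sm d ι i a), dz_bb,
      dz_zdz N hw, delT_hh]
    ring

theorem gc_KK {N T M : ℝ} (hN : 4 ≤ N) (hT : 0 < T) {n : ℕ} (j l : ℕ) (hjl : j + l ≤ n) :
    ∃ C ≥ (0:ℝ), ∀ d : Dat T M, dbl N T (grad N l (KK N j d)) ≤ C * R2 N n d := by
  rcases Nat.eq_zero_or_pos n with rfl | hn
  · refine ⟨0, le_rfl, fun d => ?_⟩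
    obtain rfl : j = 0 := by omega
    have h0 : ∀ t z, KK N 0 d t z = 0 := by intro t z; simp [KK]
    have : grad N l (KK N 0 d) = fun _ _ => 0 := by
      funext t z; exact grad_zero_at (h0 t) l z
    rw [this]; simp [dbl, sq]
  rcases Nat.even_or_odd' l with ⟨m, rfl | rfl⟩
  · obtain ⟨-, C, hC, h⟩ := gc_even hN hT hn (KK_delT N T M j m) (by omega)
    refine ⟨C, hC, fun d => ?_⟩
    rw [grad_even]; exact h d
  · obtain ⟨-, C, hC, h⟩ := gc_odd hN hT hn (KK_delT N T M j m) (by omega)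
    refine ⟨C, hC, fun d => ?_⟩
    rw [grad_odd]; exact h d

end S13

namespace S13

theorem KK_all {N T : ℝ} (hN : 4 ≤ N) (hT : 0 < T) (n : ℕ) (M : ℝ) :
    ∃ C ≥ (0:ℝ), ∀ (d : Dat T M) (j l : ℕ), j + l ≤ n →
      dbl N T (grad N l (KK N j d)) ≤ C * R2 N n d := by
  have h : ∀ p : ℕ × ℕ, ∃ C ≥ (0:ℝ), p.1 + p.2 ≤ n → ∀ d : Dat T M,
      dbl N T (grad N p.2 (KK N p.1 d)) ≤ C * R2 N n d := by
    intro p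
    by_cases hp : p.1 + p.2 ≤ n
    · obtain ⟨C, hC, h⟩ := gc_KK (M := M) hN hT p.1 p.2 hp
      exact ⟨C, hC, fun _ => h⟩
    · exact ⟨0, le_rfl, fun h => absurd h hp⟩
  choose C hC h using h
  refine ⟨∑ p ∈ Finset.range (n + 1) ×ˢ Finset.range (n + 1), C p,
    Finset.sum_nonneg fun p _ => hC p, fun d j l hjl => ?_⟩
  refine (h (j, l) hjl d).trans (mul_le_mul_of_nonneg_right ?_ (R2_nonneg N n d))
  apply Finset.single_le_sum (f := C) (fun p _ => hC p)
  simp; omega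

theorem KK_sm (N : ℝ) {T M : ℝ} (j : ℕ) (d : Dat T M) : Sm (KK N j d) := (KK_cl N T M j).sm d

set_option maxHeartbeats 1600000 in
theorem main_j {N T : ℝ} (hN : 4 ≤ N) (hT : 0 < T) (n : ℕ) (M : ℝ) :
    ∃ D > (0:ℝ), ∀ (d : Dat T M) (G : ℝ → ℝ → ℝ), Sm G → ∀ j ≤ n,
      Real.sqrt (∫ t in (0:ℝ)..T, (normN N (n - j) (fun z => dt^[j] G t z - KK N j d t z)) ^ 2)
      ≤ D * (normT N T n G + normT N T (n + 1) d.H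
        + (∑ ι, supNT T (n + 4) (d.b ι)) * normT N T 2 d.H) := by
  obtain ⟨C, hC, h⟩ := KK_all hN hT n M
  set D : ℝ := (n + 1) * (2 + 2 * C) with hD
  have hD1 : 1 ≤ D := by
    have : (0:ℝ) ≤ n := by positivity
    rw [hD]; nlinarith
  refine ⟨D, by linarith, fun d G hG j hj => ?_⟩
  have hsm := (hG.dt_iter j).sub (KK_sm N j d)
  rw [int_normN (T := T) hN (n - j) hsm]
  set x := normT N T n G with hx
  set y := normT N T (n + 1) d.H with hy
  set w := normT N T 2 d.H with hw
  set S := ∑ ι, supNT T (n + 4) (d.b ι) with hS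
  have x0 : 0 ≤ x := Real.sqrt_nonneg _
  have y0 : 0 ≤ y := Real.sqrt_nonneg _
  have w0 : 0 ≤ w := Real.sqrt_nonneg _
  have S0 : 0 ≤ S := Finset.sum_nonneg fun _ _ => supNT_nonneg _ _ _
  have hv0 : 0 ≤ S * w := mul_nonneg S0 w0
  apply Real.sqrt_le_iff.2
  refine ⟨by positivity, ?_⟩
  have hterm : ∀ l ∈ Finset.range (n - j + 1),
      dbl N T (grad N l (fun t z => dt^[j] G t z - KK N j d t z))
        ≤ (2 + 2 * C) * (x + y + S * w) ^ 2 := by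
    intro l hl
    have hl' : j + l ≤ n := by
      have := Finset.mem_range.1 hl; omega
    have c1 := (hG.dt_iter j).grad_co N l
    have c2 := (KK_sm N j d).grad_co N l
    have e : grad N l (fun t z => dt^[j] G t z - KK N j d t z)
        = fun t z => grad N l (dt^[j] G) t z + (-1) * grad N l (KK N j d) t z := by
      rw [grad_sub N l (hG.dt_iter j) (KK_sm N j d)]; funext t z; ring
    rw [e]
    have a1 := dbl_add hN hT c1 (c2.smul (-1)) (T := T)
    rw [dbl_smul] at a1
    have a2 := dbl_le_hsq hN hT hl' hG
    have a3 := h d j l hl'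
    have a4 : R2 N n d = y ^ 2 + S ^ 2 * w ^ 2 := rfl
    have a5 : hsq N T n G = x ^ 2 := rfl
    rw [a4] at a3
    rw [a5] at a2
    have b1 : x ^ 2 ≤ (x + y + S * w) ^ 2 := by gcongr; linarith
    have b2 : y ^ 2 + S ^ 2 * w ^ 2 ≤ (x + y + S * w) ^ 2 := by
      nlinarith [mul_nonneg x0 y0, mul_nonneg x0 hv0, mul_nonneg y0 hv0, sq_nonneg x]
    have b3 := mul_le_mul_of_nonneg_left b2 hC
    linarith
  calc _ ≤ ∑ l ∈ Finset.range (n - j + 1), (2 + 2 * C) * (x + y + S * w) ^ 2 :=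
        Finset.sum_le_sum hterm
    _ = ((n - j + 1 : ℕ) : ℝ) * ((2 + 2 * C) * (x + y + S * w) ^ 2) := by
        rw [Finset.sum_const, Finset.card_range, nsmul_eq_mul]
    _ ≤ (n + 1) * ((2 + 2 * C) * (x + y + S * w) ^ 2) := by
        have : ((n - j + 1 : ℕ) : ℝ) ≤ n + 1 := by exact_mod_cast (by omega)
        gcongr
    _ = D * (x + y + S * w) ^ 2 := by rw [hD]; ring
    _ ≤ D ^ 2 * (x + y + S * w) ^ 2 := by gcongr; nlinarith
    _ = _ := by ring

end S13

theorem stmt13 (N : ℝ) (hN : 4 ≤ N) (T : ℝ) (hT : 0 < T) (n : ℕ) (M : ℝ) (hM : 0 < M) :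
    ∃ C > (0:ℝ), ∀ b₂ b₁ b₀ G H : ℝ → ℝ → ℝ, ∀ τ₂ : ℝ,
      ContDiff ℝ (⊤ : ℕ∞) (fun p : ℝ × ℝ => b₂ p.1 p.2) →
      ContDiff ℝ (⊤ : ℕ∞) (fun p : ℝ × ℝ => b₁ p.1 p.2) →
      ContDiff ℝ (⊤ : ℕ∞) (fun p : ℝ × ℝ => b₀ p.1 p.2) →
      (∀ t ∈ Icc (0:ℝ) T, ∀ z ∈ Icc (0:ℝ) 1, |b₂ t z - 1| ≤ 1 / 2) →
      supNT T 6 b₂ + supNT T 6 b₁ + supNT T 6 b₀ ≤ M →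
      τ₂ ∈ Ioo (0:ℝ) T →
      ContDiff ℝ (⊤ : ℕ∞) (fun p : ℝ × ℝ => G p.1 p.2) →
      (∀ t ∈ Icc (0:ℝ) τ₂, ∀ z : ℝ, G t z = 0) →
      ContDiff ℝ (⊤ : ℕ∞) (fun p : ℝ × ℝ => H p.1 p.2) →
      (∀ t ∈ Icc (0:ℝ) T, ∀ z ∈ Ioo (0:ℝ) 1,
        dt (dt H) t z + opA N b₂ b₁ b₀ H t z = G t z) →
      (∀ t ∈ Icc (0:ℝ) T, H t 1 = 0) →
      (∀ t ∈ Icc (0:ℝ) τ₂, ∀ z : ℝ, H t z = 0) →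
      (∑ j ∈ Finset.range (n + 1), Real.sqrt (∫ t in (0:ℝ)..T,
          (normN N (n - j) (fun z => dt^[j] G t z
            - (dt^[j] (opA N b₂ b₁ b₀ H) t z - opA N b₂ b₁ b₀ (dt^[j] H) t z))) ^ 2))
        ≤ C * (normT N T n G + normT N T (n + 1) H
            + (supNT T (n + 4) b₂ + supNT T (n + 4) b₁ + supNT T (n + 4) b₀) * normT N T 2 H
            + (supNT T (n + 5) b₂ + supNT T (n + 5) b₁ + supNT T (n + 5) b₀)
                * normT N T 1 H) := by
  obtain ⟨D, hD, h⟩ := S13.main_j hN hT n M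
  refine ⟨(n + 1) * D, by positivity, ?_⟩
  intro b₂ b₁ b₀ G H τ₂ s2 s1 s0 _ hsup hτ sG _ sH _ _ hH
  have p2 := S13.supNT_nonneg T 6 b₂
  have p1 := S13.supNT_nonneg T 6 b₁
  have p0 := S13.supNT_nonneg T 6 b₀
  let d : S13.Dat T M :=
    { b := ![b₂, b₁, b₀]
      H := H
      τ := τ₂
      hb := by
        intro ι
        fin_cases ι
        · exact s2
        · exact s1
        · exact s0
      hH := sH
      hτ := hτ.1
      h0 := hH
      hM := by
        intro ι
        fin_cases ι
        · show supNT T 6 b₂ ≤ M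
          linarith
        · show supNT T 6 b₁ ≤ M
          linarith
        · show supNT T 6 b₀ ≤ M
          linarith }
  have hS : (∑ ι, supNT T (n + 4) (d.b ι))
      = supNT T (n + 4) b₂ + supNT T (n + 4) b₁ + supNT T (n + 4) b₀ := by
    rw [Fin.sum_univ_three]; rfl
  have hj := h d G sG
  rw [hS] at hj
  have hlast : 0 ≤ (supNT T (n + 5) b₂ + supNT T (n + 5) b₁ + supNT T (n + 5) b₀)
      * normT N T 1 H := by
    have q2 := S13.supNT_nonneg T (n + 5) b₂
    have q1 := S13.supNT_nonneg T (n + 5) b₁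
    have q0 := S13.supNT_nonneg T (n + 5) b₀
    have : 0 ≤ normT N T 1 H := Real.sqrt_nonneg _
    positivity
  calc _ ≤ ∑ j ∈ Finset.range (n + 1), D * (normT N T n G + normT N T (n + 1) H
            + (supNT T (n + 4) b₂ + supNT T (n + 4) b₁ + supNT T (n + 4) b₀) * normT N T 2 H) :=
        Finset.sum_le_sum fun j hjn => hj j (by have := Finset.mem_range.1 hjn; omega)
    _ = (n + 1) * D * (normT N T n G + normT N T (n + 1) H
            + (supNT T (n + 4) b₂ + supNT T (n + 4) b₁ + supNT T (n + 4) b₀) * normT N T 2 H) := by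
        rw [Finset.sum_const, Finset.card_range, nsmul_eq_mul]; push_cast; ring
    _ ≤ _ := by
        apply mul_le_mul_of_nonneg_left _ (by positivity)
        linarith
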